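/- The transpose top-2 with random shuffle exhibits the total variation cutoff phenomenon at time (n−3/2)·log n with window of order n: lim_{c→∞} limsup_{n→∞} ‖P^{*⌈(n−3/2)·log n + c·n⌉} − U_{A_n}‖_TV = 0 and lim_{c→−∞} liminf_{n→∞} ‖P^{*⌈(n−3/2)·log n + c·n⌉} − U_{A_n}‖_TV = 1. -/

import Mathlib

open scoped Classical
open Filter

noncomputable def convolve {G : Type*} [Group G] [Fintype G] (α β : G → ℝ) : G → ℝ :=
  fun x => ∑ g : G, α g * β (g⁻¹ * x)

noncomputable def convPow {G : Type*} [Group G] [Fintype G] (γ : G → ℝ) : ℕ → G → ℝ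
  | 0 => fun x => if x = 1 then 1 else 0
  | k + 1 => convolve (convPow γ k) γ

noncomputable def tvDist {Ω : Type*} [Fintype Ω] (p q : Ω → ℝ) : ℝ :=
  (∑ ω : Ω, |p ω - q ω|) / 2

noncomputable def unif (Ω : Type*) [Fintype Ω] : Ω → ℝ := fun _ => 1 / (Fintype.card Ω)

/-- The transpose top-2 with random shuffle measure on `A_n`: mass `1/(2n-3)` on the
identity and on each 3-cycle of the form `(i, n-1, n)` or `(i, n, n-1)` with
`1 ≤ i ≤ n-2`; these 3-cycles are exactly the 3-cycles whose support contains both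
of the two largest points. -/
noncomputable def Pmeas (n : ℕ) : alternatingGroup (Fin n) → ℝ := fun π =>
  if (π : Equiv.Perm (Fin n)) = 1 then 1 / (2 * (n : ℝ) - 3)
  else if (π : Equiv.Perm (Fin n)).IsThreeCycle ∧
      (∀ x : Fin n, n - 2 ≤ (x : ℕ) → x ∈ (π : Equiv.Perm (Fin n)).support) then
    1 / (2 * (n : ℝ) - 3)
  else 0

/-- The measure `P'` on `A_n`: mass `1/(n-1)` on the identity and `1/(n-1)^2` on each
3-cycle of the form `(i,j,n)` or `(j,i,n)` with `1 ≤ i < j ≤ n-1`; these are exactly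
the 3-cycles whose support contains the largest point. -/
noncomputable def P'meas (n : ℕ) : alternatingGroup (Fin n) → ℝ := fun π =>
  if (π : Equiv.Perm (Fin n)) = 1 then 1 / ((n : ℝ) - 1)
  else if (π : Equiv.Perm (Fin n)).IsThreeCycle ∧
      (∀ x : Fin n, (x : ℕ) = n - 1 → x ∈ (π : Equiv.Perm (Fin n)).support) then
    1 / ((n : ℝ) - 1) ^ 2
  else 0

/-- The measure `Q` on `A_n` giving mass `3/(n(n-1)(n-2))` to every 3-cycle. -/
noncomputable def Qmeas (n : ℕ) : alternatingGroup (Fin n) → ℝ := fun π =>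
  if (π : Equiv.Perm (Fin n)).IsThreeCycle then
    3 / ((n : ℝ) * ((n : ℝ) - 1) * ((n : ℝ) - 2))
  else 0


section spectral
variable {V : Type*} [NormedAddCommGroup V] [InnerProductSpace ℝ V] [FiniteDimensional ℝ V]

/-- expansion of the quadratic form in an eigenbasis -/
lemma quad_expand (T : V →ₗ[ℝ] V) (hT : T.IsSymmetric) {N : ℕ} (hN : Module.finrank ℝ V = N)
    (v : V) :
    inner ℝ (T v) v = ∑ i, hT.eigenvalues hN i * (inner ℝ (hT.eigenvectorBasis hN i) v) ^ 2 := by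
  rw [← (hT.eigenvectorBasis hN).sum_inner_mul_inner]
  refine Finset.sum_congr rfl fun i _ => ?_
  rw [hT v, hT.apply_eigenvectorBasis, real_inner_comm]
  simp only [RCLike.ofReal_real_eq_id, id_eq, inner_smul_left, conj_trivial]
  ring

lemma norm_expand {N : ℕ} (b : OrthonormalBasis (Fin N) ℝ V) (v : V) :
    ‖v‖ ^ 2 = ∑ i, (inner ℝ (b i) v) ^ 2 := by
  rw [← b.sum_sq_norm_inner_right]
  simp

/-- a large Rayleigh quotient gives an eigenvector -/
lemma exists_eig_gt (T : V →ₗ[ℝ] V) (hT : T.IsSymmetric) (t : ℝ) (v : V)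
    (h : t * ‖v‖ ^ 2 < inner ℝ (T v) v) : ∃ (b : ℝ) (w : V), w ≠ 0 ∧ T w = b • w ∧ t < b := by
  by_contra hcon
  push Not at hcon
  rw [quad_expand T hT rfl, norm_expand (hT.eigenvectorBasis rfl), Finset.mul_sum] at h
  refine absurd h (not_lt.2 (Finset.sum_le_sum fun i _ => ?_))
  refine mul_le_mul_of_nonneg_right ?_ (sq_nonneg _)
  refine hcon _ (hT.eigenvectorBasis rfl i) ?_ ?_
  · intro h0
    have := (hT.eigenvectorBasis rfl).orthonormal.1 i
    rw [h0] at this; simp at this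
  · exact hT.apply_eigenvectorBasis rfl i

lemma exists_eig_gt_inv (T : V →ₗ[ℝ] V) (hT : T.IsSymmetric) (K : Submodule ℝ V)
    (hK : ∀ v ∈ K, T v ∈ K) (t : ℝ) (v : V) (hv : v ∈ K)
    (h : t * ‖v‖ ^ 2 < inner ℝ (T v) v) :
    ∃ (b : ℝ) (w : V), w ∈ K ∧ w ≠ 0 ∧ T w = b • w ∧ t < b := by
  obtain ⟨b, w, hw0, hw, hb⟩ := exists_eig_gt (T.restrict hK) (hT.restrict_invariant hK) t ⟨v, hv⟩ h
  refine ⟨b, w, w.2, ?_, ?_, hb⟩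
  · simpa using hw0
  · simpa using congrArg Subtype.val hw

lemma exists_eig_inv (T : V →ₗ[ℝ] V) (hT : T.IsSymmetric) (K : Submodule ℝ V)
    (hK : ∀ v ∈ K, T v ∈ K) (v : V) (hv : v ∈ K) (h0 : v ≠ 0) :
    ∃ (b : ℝ) (w : V), w ∈ K ∧ w ≠ 0 ∧ T w = b • w := by
  have hp : 0 < ‖v‖ ^ 2 := by positivity
  obtain ⟨b, w, h1, h2, h3, _⟩ := exists_eig_gt_inv T hT K hK
    (inner ℝ (T v) v / ‖v‖ ^ 2 - 1) v hv (by
      rw [sub_mul, div_mul_cancel₀ _ hp.ne']; linarith)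
  exact ⟨b, w, h1, h2, h3⟩

/-- joint eigenvectors -/
lemma exists_joint (T S : V →ₗ[ℝ] V) (hS : S.IsSymmetric) (hTS : ∀ v, T (S v) = S (T v))
    (K : Submodule ℝ V) (hK : ∀ v ∈ K, S v ∈ K) (b : ℝ) (v : V) (hv : v ∈ K) (h0 : v ≠ 0)
    (hb : T v = b • v) :
    ∃ (a : ℝ) (w : V), w ∈ K ∧ w ≠ 0 ∧ T w = b • w ∧ S w = a • w := by
  obtain ⟨a, w, h1, h2, h3⟩ := exists_eig_inv S hS (K ⊓ LinearMap.ker (T - b • LinearMap.id))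
    (by
      intro u hu
      refine ⟨hK u hu.1, ?_⟩
      have := hu.2
      simp only [LinearMap.mem_ker, LinearMap.sub_apply, LinearMap.smul_apply, LinearMap.id_apply,
        sub_eq_zero, SetLike.mem_coe] at this ⊢
      rw [hTS, this, map_smul]) v ⟨hv, by simp [hb]⟩ h0
  refine ⟨a, w, h1.1, h2, ?_, h3⟩
  have := h1.2
  simpa [sub_eq_zero] using this

/-- counting eigenvalues -/
lemma count_eig (T : V →ₗ[ℝ] V) (hT : T.IsSymmetric) {N : ℕ} (hN : Module.finrank ℝ V = N)
    (e : ℝ)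
    (K : Submodule ℝ V) (t : ℝ) (hK : ∀ v ∈ K, e * inner ℝ (T v) v ≤ t * ‖v‖ ^ 2) :
    (Finset.univ.filter (fun i => t < e * hT.eigenvalues hN i)).card
      + Module.finrank ℝ K ≤ N := by
  set F := Finset.univ.filter (fun i => t < e * hT.eigenvalues hN i) with hF
  set b := hT.eigenvectorBasis hN
  let M := Submodule.span ℝ (Set.range (fun i : F => b i))
  have hli : LinearIndependent ℝ (fun i : F => b i) :=
    b.orthonormal.linearIndependent.comp _ Subtype.val_injective
  have hM : Module.finrank ℝ M = F.card := by
    rw [finrank_span_eq_card hli]; simp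
  have hout : ∀ v ∈ M, ∀ i, i ∉ F → inner ℝ (b i) v = 0 := by
    intro v hv i hi
    induction hv using Submodule.span_induction with
    | mem x hx =>
      obtain ⟨j, rfl⟩ := hx
      apply b.orthonormal.2
      rintro rfl
      exact hi j.2
    | zero => simp
    | add x y _ _ hx hy => rw [inner_add_right, hx, hy, add_zero]
    | smul a x _ hx => rw [inner_smul_right, hx, mul_zero]
  have hdis : M ⊓ K = ⊥ := by
    rw [eq_bot_iff]
    rintro v ⟨hv, hvK⟩
    have h1 := hK v hvK
    rw [quad_expand T hT hN, norm_expand b, Finset.mul_sum, Finset.mul_sum, ← sub_nonneg,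
      ← Finset.sum_sub_distrib] at h1
    have h2 : ∀ i ∈ Finset.univ, t * (inner ℝ (b i) v) ^ 2 -
        e * (hT.eigenvalues hN i * (inner ℝ (b i) v) ^ 2) ≤ 0 := by
      intro i _
      by_cases hi : i ∈ F
      · have : t < e * hT.eigenvalues hN i := by simpa [hF] using hi
        nlinarith [sq_nonneg (inner ℝ (b i) v)]
      · rw [hout v hv i hi]; simp
    have h3 := (Finset.sum_eq_zero_iff_of_nonpos h2).1 (le_antisymm (Finset.sum_nonpos h2) h1)
    have h4 : ∀ i, inner ℝ (b i) v = 0 := by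
      intro i
      by_cases hi : i ∈ F
      · have : t < e * hT.eigenvalues hN i := by simpa [hF] using hi
        have h5 := h3 i (Finset.mem_univ _)
        have h6 : (t - e * hT.eigenvalues hN i) * (inner ℝ (b i) v) ^ 2 = 0 := by linarith
        rcases mul_eq_zero.1 h6 with h | h
        · linarith
        · exact pow_eq_zero_iff (two_ne_zero) |>.1 h
      · exact hout v hv i hi
    have : ‖v‖ ^ 2 = 0 := by rw [norm_expand b]; simp [h4]
    simpa using this
  have := Submodule.finrank_sup_add_finrank_inf_eq M K
  rw [hdis, finrank_bot, add_zero, hM] at this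
  rw [← this, ← hN]
  exact Submodule.finrank_le _

/-- Hilbert-Schmidt norm -/
lemma hs_norm (T : V →ₗ[ℝ] V) (hT : T.IsSymmetric) {N : ℕ} (hN : Module.finrank ℝ V = N)
    {ι : Type*} [Fintype ι] (d : OrthonormalBasis ι ℝ V) (k : ℕ) :
    ∑ g, ‖(T ^ k) (d g)‖ ^ 2 = ∑ i, (hT.eigenvalues hN i) ^ (2 * k) := by
  set b := hT.eigenvectorBasis hN with hb
  have hpow : ∀ i, (T ^ k) (b i) = (hT.eigenvalues hN i) ^ k • b i := by
    intro i
    induction k with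
    | zero => simp
    | succ k ih =>
      rw [pow_succ', Module.End.mul_apply, ih, map_smul, hb, hT.apply_eigenvectorBasis, smul_smul]
      rfl
  have hsym : ∀ x y, inner ℝ ((T ^ k) x) y = inner ℝ x ((T ^ k) y) := hT.pow k
  calc ∑ g, ‖(T ^ k) (d g)‖ ^ 2 = ∑ g, ∑ i, (inner ℝ (b i) ((T ^ k) (d g))) ^ 2 :=
        Finset.sum_congr rfl fun g _ => norm_expand b _
    _ = ∑ i, ∑ g, (inner ℝ (d g) ((T ^ k) (b i))) ^ 2 := by
        rw [Finset.sum_comm]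
        refine Finset.sum_congr rfl fun i _ => Finset.sum_congr rfl fun g _ => ?_
        rw [← hsym, real_inner_comm]
    _ = _ := by
        refine Finset.sum_congr rfl fun i _ => ?_
        have := d.sum_sq_norm_inner_right ((T ^ k) (b i))
        simp only [Real.norm_eq_abs, sq_abs] at this
        rw [this, hpow, norm_smul, b.orthonormal.1 i, mul_one, Real.norm_eq_abs, sq_abs, ← pow_mul,
          mul_comm]
end spectral

section rep
set_option linter.unusedSectionVars false
set_option linter.unusedVariables false
variable {V : Type*} [NormedAddCommGroup V] [InnerProductSpace ℝ V] [FiniteDimensional ℝ V]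
variable {α : Type*} [Fintype α] [DecidableEq α]
open Equiv

/-- Jucys-Murphy type operator on the positions `B` with centre `c` -/
noncomputable def JM (ρ : Perm α →* Module.End ℝ V) (B : Finset α) (c : α) : V →ₗ[ℝ] V :=
  ∑ i ∈ B.erase c, ρ (swap i c)

/-- vectors orthogonal to every vector invariant under a symmetric group on `r` points of `B` -/
def KK (ρ : Perm α →* Module.End ℝ V) (B : Finset α) (r : ℕ) : Submodule ℝ V where
  carrier := {v | ∀ Z ⊆ B, Z.card = r → ∀ u : V,
    (∀ i ∈ Z, ∀ j ∈ Z, ρ (swap i j) u = u) → inner ℝ u v = 0}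
  add_mem' := by
    intro a b ha hb Z hZ hr u hu
    rw [inner_add_right, ha Z hZ hr u hu, hb Z hZ hr u hu, add_zero]
  zero_mem' := by intro Z _ _ u _; simp
  smul_mem' := by
    intro c a ha Z hZ hr u hu
    rw [inner_smul_right, ha Z hZ hr u hu, mul_zero]

variable (ρ : Perm α →* Module.End ℝ V) (hρ : ∀ g x y, inner ℝ (ρ g x) (ρ g y) = inner ℝ x y)

lemma KK_mono {B C : Finset α} (h : B ⊆ C) (r : ℕ) : KK ρ C r ≤ KK ρ B r :=
  fun _ hv Z hZ => hv Z (hZ.trans h)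

lemma rho_mul (g h : Perm α) (v : V) : ρ g (ρ h v) = ρ (g * h) v := by
  rw [map_mul]; rfl

lemma swap_swap_rho (i j : α) (v : V) : ρ (swap i j) (ρ (swap i j) v) = v := by
  rw [rho_mul, swap_mul_self, map_one]; rfl

include hρ in
lemma swap_symm_rho (i j : α) (x y : V) :
    inner ℝ (ρ (swap i j) x) y = inner ℝ x (ρ (swap i j) y) := by
  rw [← hρ (swap i j), swap_swap_rho]

include hρ in
lemma KK_swap {B : Finset α} {r : ℕ} {i j : α} (hi : i ∈ B) (hj : j ∈ B) {v : V}
    (hv : v ∈ KK ρ B r) : ρ (swap i j) v ∈ KK ρ B r := by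
  intro Z hZ hr u hu
  rw [← swap_symm_rho ρ hρ]
  refine hv (Z.map (swap i j).toEmbedding) ?_ (by simpa using hr) _ ?_
  · intro x hx
    obtain ⟨y, hy, rfl⟩ := Finset.mem_map.1 hx
    have := hZ hy
    simp only [Equiv.coe_toEmbedding, swap_apply_def]
    split_ifs <;> assumption
  · intro x hx y hy
    obtain ⟨x, hx', rfl⟩ := Finset.mem_map.1 hx
    obtain ⟨y, hy', rfl⟩ := Finset.mem_map.1 hy
    have h1 : swap i j * swap x y = swap (swap i j x) (swap i j y) * swap i j := by
      ext z; simp [Equiv.swap_apply_apply]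
    simp only [Equiv.coe_toEmbedding]
    rw [rho_mul, ← h1, ← rho_mul, hu x hx' y hy']

lemma JM_apply (B : Finset α) (c : α) (v : V) :
    JM ρ B c v = ∑ i ∈ B.erase c, ρ (swap i c) v := by
  simp [JM, LinearMap.sum_apply]

include hρ in
lemma JM_symm (B : Finset α) (c : α) : (JM ρ B c).IsSymmetric := by
  intro x y
  rw [JM_apply, JM_apply, sum_inner, inner_sum]
  exact Finset.sum_congr rfl fun i _ => swap_symm_rho ρ hρ _ _ _ _

include hρ in
lemma JM_mem {B C : Finset α} (h : C ⊆ B) {c : α} (hc : c ∈ B) {r : ℕ} {v : V}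
    (hv : v ∈ KK ρ B r) : JM ρ C c v ∈ KK ρ B r := by
  rw [JM_apply]
  exact Submodule.sum_mem _ fun i hi =>
    KK_swap ρ hρ (h (Finset.mem_of_mem_erase hi)) hc hv

lemma swap_conj (i j x y : α) : swap i j * swap x y = swap (swap i j x) (swap i j y) * swap i j := by
  ext z; simp [Equiv.swap_apply_apply]

/-- `J` commutes with swaps of the non-central points -/
lemma JM_comm_swap {B : Finset α} {c i d : α} (hi : i ∈ B.erase c) (hd : d ∈ B.erase c) (v : V) :
    JM ρ B c (ρ (swap i d) v) = ρ (swap i d) (JM ρ B c v) := by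
  rw [JM_apply, JM_apply, map_sum]
  refine Finset.sum_bij' (fun x _ => swap i d x) (fun x _ => swap i d x) ?_ ?_ ?_ ?_ ?_
  · intro x hx; rw [swap_apply_def]; split_ifs <;> assumption
  · intro x hx; rw [swap_apply_def]; split_ifs <;> assumption
  · intro x _; simp
  · intro x _; simp
  · intro x _
    have hc : swap i d c = c := swap_apply_of_ne_of_ne (Finset.ne_of_mem_erase hi).symm
      (Finset.ne_of_mem_erase hd).symm
    rw [rho_mul, rho_mul, swap_conj i d (swap i d x) c, swap_apply_self, hc]

lemma JM_comm {B : Finset α} {c d : α} (hd : d ∈ B.erase c) (v : V) :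
    JM ρ B c (JM ρ (B.erase c) d v) = JM ρ (B.erase c) d (JM ρ B c v) := by
  rw [JM_apply ρ (B.erase c) d, JM_apply ρ (B.erase c) d, map_sum]
  exact Finset.sum_congr rfl fun i hi => JM_comm_swap ρ (Finset.mem_of_mem_erase hi) hd v

lemma JM_tau {B : Finset α} {c d : α} (hd : d ∈ B.erase c) (v : V) :
    JM ρ B c (ρ (swap d c) v) = ρ (swap d c) (JM ρ (B.erase c) d v) + v := by
  rw [JM_apply, JM_apply, ← Finset.add_sum_erase _ _ hd, swap_swap_rho, add_comm, map_sum]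
  congr 1
  refine Finset.sum_congr rfl fun i hi => ?_
  rw [rho_mul, rho_mul, swap_conj d c i d, swap_apply_left,
    swap_apply_of_ne_of_ne (Finset.ne_of_mem_erase hi)
      (Finset.ne_of_mem_erase (Finset.mem_of_mem_erase hi))]

include hρ in
lemma pair_inner {B : Finset α} {c d : α} (hc : c ∈ B) (hd : d ∈ B.erase c) {v : V} {a b : ℝ}
    (hb : JM ρ B c v = b • v) (ha : JM ρ (B.erase c) d v = a • v) :
    (b - a) * inner ℝ v (ρ (swap d c) v) = ‖v‖ ^ 2 := by
  have h1 := JM_tau ρ hd v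
  have h2 : inner ℝ v (JM ρ B c (ρ (swap d c) v)) = b * inner ℝ v (ρ (swap d c) v) := by
    rw [← JM_symm ρ hρ B c, hb, inner_smul_left]; simp
  rw [h1, ha, inner_add_right, map_smul, inner_smul_right, real_inner_self_eq_norm_sq] at h2
  linarith

include hρ in
lemma norm_rho (g : Perm α) (v : V) : ‖ρ g v‖ = ‖v‖ := by
  have := hρ g v v
  rw [real_inner_self_eq_norm_sq, real_inner_self_eq_norm_sq] at this
  exact (sq_eq_sq₀ (norm_nonneg _) (norm_nonneg _)).1 this

include hρ in
lemma pair_sep {B : Finset α} {c d : α} (hc : c ∈ B) (hd : d ∈ B.erase c) {v : V} {a b : ℝ}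
    (h0 : v ≠ 0) (hb : JM ρ B c v = b • v) (ha : JM ρ (B.erase c) d v = a • v) : 1 ≤ |b - a| := by
  have h := pair_inner ρ hρ hc hd hb ha
  have hp : 0 < ‖v‖ ^ 2 := by positivity
  have h1 : |inner ℝ v (ρ (swap d c) v)| ≤ ‖v‖ ^ 2 := by
    have := abs_real_inner_le_norm v (ρ (swap d c) v)
    rwa [norm_rho ρ hρ, ← sq] at this
  have h2 : ‖v‖ ^ 2 = |b - a| * |inner ℝ v (ρ (swap d c) v)| := by
    rw [← abs_mul, h, abs_of_pos hp]
  by_contra hcon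
  push Not at hcon
  nlinarith [abs_nonneg (b - a), abs_nonneg (inner ℝ v (ρ (swap d c) v))]

include hρ in
/-- eigenvalues are integers -/
lemma JM_int : ∀ (s : ℕ) (B : Finset α), B.card = s → ∀ c ∈ B, ∀ (v : V) (b : ℝ), v ≠ 0 →
    JM ρ B c v = b • v → ∃ z : ℤ, b = z := by
  intro s
  induction s with
  | zero =>
    intro B hB c hc
    rw [Finset.card_eq_zero] at hB; simp [hB] at hc
  | succ s ih =>
    intro B hB c hc v b h0 hb
    rcases (B.erase c).eq_empty_or_nonempty with he | ⟨d, hd⟩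
    · rw [JM_apply, he, Finset.sum_empty] at hb
      refine ⟨0, ?_⟩
      rcases smul_eq_zero.1 hb.symm with h | h
      · simpa using h
      · exact absurd h h0
    · have hcard : (B.erase c).card = s := by rw [Finset.card_erase_of_mem hc, hB]; rfl
      obtain ⟨a, w, -, hw0, hwb, hwa⟩ := exists_joint (JM ρ B c) (JM ρ (B.erase c) d)
        (JM_symm ρ hρ _ _) (JM_comm ρ hd) ⊤ (fun _ _ => trivial) b v trivial h0 hb
      obtain ⟨z, hz⟩ := ih _ hcard d hd w a hw0 hwa
      have hin := pair_inner ρ hρ hc hd hwb hwa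
      have hp : 0 < ‖w‖ ^ 2 := by positivity
      have hne : b - a ≠ 0 := by
        intro h; rw [h, zero_mul] at hin; exact hp.ne hin
      by_cases hu : ρ (swap d c) w = (b - a)⁻¹ • w
      · have h1 := swap_swap_rho ρ d c w
        rw [hu, map_smul, hu, smul_smul] at h1
        have h2 : ((b - a)⁻¹ * (b - a)⁻¹ - 1) • w = 0 := by rw [sub_smul, h1]; simp
        rcases smul_eq_zero.1 h2 with h | h
        · have h3 : (b - a) ^ 2 = 1 := by field_simp at h; linarith
          rcases mul_eq_zero.1 (show (b - a - 1) * (b - a + 1) = 0 by linarith) with h | h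
          · exact ⟨z + 1, by push_cast; linarith⟩
          · exact ⟨z - 1, by push_cast; linarith⟩
        · exact absurd h hw0
      · refine ih _ hcard d hd (ρ (swap d c) w - (b - a)⁻¹ • w) b (sub_ne_zero.2 hu) ?_
        have h1 := JM_tau ρ hd (ρ (swap d c) w)
        rw [swap_swap_rho, hwb] at h1
        have h2 : JM ρ (B.erase c) d (ρ (swap d c) w) = b • ρ (swap d c) w - w := by
          have := congrArg (ρ (swap d c)) h1
          rw [map_add, swap_swap_rho, swap_swap_rho, map_smul] at this
          rw [this]; simp
        rw [map_sub, map_smul, h2, hwa, smul_sub, smul_smul, smul_smul, sub_sub]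
        congr 1
        nth_rewrite 1 [← one_smul ℝ w]
        rw [← add_smul]
        congr 1
        field_simp
        ring
end rep

section rep2
set_option linter.unusedSectionVars false
set_option linter.unusedVariables false
variable {V : Type*} [NormedAddCommGroup V] [InnerProductSpace ℝ V] [FiniteDimensional ℝ V]
variable {α : Type*} [Fintype α] [DecidableEq α]
open Equiv
variable (ρ : Perm α →* Module.End ℝ V) (hρ : ∀ g x y, inner ℝ (ρ g x) (ρ g y) = inner ℝ x y)

lemma inv_of_star {B : Finset α} {c : α} {v : V}
    (h : ∀ i ∈ B.erase c, ρ (swap i c) v = v) : ∀ i ∈ B, ∀ j ∈ B, ρ (swap i j) v = v := by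
  have h' : ∀ i ∈ B, ρ (swap i c) v = v := by
    intro i hi
    by_cases hic : i = c
    · rw [hic, swap_self]; exact congrFun (congrArg _ (map_one ρ)) v
    · exact h i (Finset.mem_erase.2 ⟨hic, hi⟩)
  intro i hi j hj
  by_cases hji : j = i
  · rw [hji, swap_self]; exact congrFun (congrArg _ (map_one ρ)) v
  by_cases hjc : j = c
  · rw [hjc]; exact h' i hi
  have h1 := congrArg (fun g => ρ g v) (swap_conj i c j c)
  simp only [← rho_mul] at h1
  rw [h' j hj, h' i hi, swap_apply_right, swap_apply_of_ne_of_ne hji hjc, swap_comm] at h1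
  exact h1.symm

include hρ in
lemma inner_rho_le (g : Perm α) (v : V) : inner ℝ (ρ g v) v ≤ ‖v‖ ^ 2 := by
  have := real_inner_le_norm (ρ g v) v
  rwa [norm_rho ρ hρ, ← sq] at this

include hρ in
lemma rho_eq_of_inner (g : Perm α) (v : V) (h : inner ℝ (ρ g v) v = ‖v‖ ^ 2) : ρ g v = v := by
  have h1 := norm_sub_sq_real (ρ g v) v
  rw [norm_rho ρ hρ, h] at h1
  have h2 : ‖ρ g v - v‖ ^ 2 = 0 := by linarith
  rw [sq_eq_zero_iff, norm_eq_zero, sub_eq_zero] at h2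
  exact h2

include hρ in
lemma JM_le_triv (B : Finset α) (c : α) (hc : c ∈ B) (v : V) :
    inner ℝ (JM ρ B c v) v ≤ ((B.card : ℝ) - 1) * ‖v‖ ^ 2 := by
  rw [JM_apply, sum_inner]
  refine (Finset.sum_le_sum fun i _ => inner_rho_le ρ hρ _ _).trans ?_
  rw [Finset.sum_const, nsmul_eq_mul, Finset.card_erase_of_mem hc,
    Nat.cast_pred (Finset.card_pos.2 ⟨c, hc⟩)]

include hρ in
lemma JM_le : ∀ (s : ℕ) (B : Finset α), B.card = s → ∀ c ∈ B, ∀ (r : ℕ), ∀ v ∈ KK ρ B r,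
    inner ℝ (JM ρ B c v) v ≤ ((r : ℝ) - 2) * ‖v‖ ^ 2 := by
  intro s
  induction s with
  | zero =>
    intro B hB c hc
    rw [Finset.card_eq_zero] at hB; simp [hB] at hc
  | succ s ih =>
    intro B hB c hc r v hv
    by_cases hrs : s + 1 < r
    · refine (JM_le_triv ρ hρ B c hc v).trans ?_
      refine mul_le_mul_of_nonneg_right ?_ (sq_nonneg _)
      rw [hB]
      have : ((s + 2 : ℕ) : ℝ) ≤ r := by exact_mod_cast hrs
      push_cast at this ⊢; linarith
    by_cases hr1 : r ≤ 1
    · have : v = 0 := by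
        obtain ⟨Z, hZ, hZr⟩ := Finset.exists_subset_card_eq
          (show r ≤ B.card by omega)
        have h1 := hv Z hZ hZr v (by
          intro i hi j hj
          have : i = j := Finset.card_le_one.1 (by omega) i hi j hj
          rw [this, swap_self]; exact congrFun (congrArg _ (map_one ρ)) v)
        exact inner_self_eq_zero.1 h1
      simp [this]
    push Not at hrs hr1
    by_contra hcon
    push Not at hcon
    obtain ⟨b, w, hwK, hw0, hwb, hb⟩ := exists_eig_gt_inv (JM ρ B c) (JM_symm ρ hρ B c) (KK ρ B r)
      (fun v hv => JM_mem ρ hρ (Finset.Subset.refl _) hc hv) _ v hv hcon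
    obtain ⟨z, hz⟩ := JM_int ρ hρ _ B rfl c hc w b hw0 hwb
    have hb1 : (r : ℝ) - 1 ≤ b := by
      rw [hz] at hb ⊢
      have : ((r : ℤ) - 2) < z := by exact_mod_cast hb
      have : ((r : ℤ) - 1) ≤ z := by omega
      exact_mod_cast this
    have hp : 0 < ‖w‖ ^ 2 := by positivity
    have hJw : inner ℝ (JM ρ B c w) w = b * ‖w‖ ^ 2 := by
      rw [hwb, inner_smul_left, real_inner_self_eq_norm_sq]; simp
    rcases hrs.eq_or_lt with hrs | hrs
    · have hinv : ∀ i ∈ B.erase c, ρ (swap i c) w = w := by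
        have hsum : ∑ i ∈ B.erase c, (‖w‖ ^ 2 - inner ℝ (ρ (swap i c) w) w) ≤ 0 := by
          rw [Finset.sum_sub_distrib, ← sum_inner, ← JM_apply, hJw, Finset.sum_const, nsmul_eq_mul,
            Finset.card_erase_of_mem hc, Nat.cast_pred (Finset.card_pos.2 ⟨c, hc⟩), hB, ← hrs]
          nlinarith
        have hnn : ∀ i ∈ B.erase c, 0 ≤ ‖w‖ ^ 2 - inner ℝ (ρ (swap i c) w) w :=
          fun i _ => sub_nonneg.2 (inner_rho_le ρ hρ _ _)
        have h0 := (Finset.sum_eq_zero_iff_of_nonneg hnn).1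
          (le_antisymm hsum (Finset.sum_nonneg hnn))
        intro i hi
        exact rho_eq_of_inner ρ hρ _ _ (by linarith [h0 i hi])
      have := hwK B (Finset.Subset.refl _) (by omega) w (inv_of_star ρ hinv)
      exact hw0 (inner_self_eq_zero.1 this)
    · have hstep : ∀ j ∈ B.erase c, b * ‖w‖ ^ 2 - inner ℝ (ρ (swap j c) w) w
          ≤ ((r : ℝ) - 2) * ‖w‖ ^ 2 := by
        intro j hj
        have hcB : c ∈ B.erase j := Finset.mem_erase.2 ⟨(Finset.ne_of_mem_erase hj).symm, hc⟩
        have h1 := ih (B.erase j) (by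
          rw [Finset.card_erase_of_mem (Finset.mem_of_mem_erase hj), hB]; rfl) c hcB r w
          (KK_mono ρ (Finset.erase_subset _ _) r hwK)
        have h2 : JM ρ B c w = JM ρ (B.erase j) c w + ρ (swap j c) w := by
          rw [JM_apply, JM_apply, Finset.erase_right_comm, Finset.sum_erase_add _ _ hj]
        rw [← hJw, h2, inner_add_left]
        linarith
      have h3 := Finset.sum_le_sum hstep
      rw [Finset.sum_sub_distrib, ← sum_inner, ← JM_apply, hJw, Finset.sum_const, Finset.sum_const,
        nsmul_eq_mul, nsmul_eq_mul, Finset.card_erase_of_mem hc,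
        Nat.cast_pred (Finset.card_pos.2 ⟨c, hc⟩), hB] at h3
      push_cast at h3
      have h4 : ((s : ℝ) - 1) * b ≤ s * ((r : ℝ) - 2) := by
        refine le_of_mul_le_mul_right ?_ hp
        nlinarith
      have h5 : (r : ℝ) < s + 1 := by exact_mod_cast hrs
      have h6 : (2 : ℝ) ≤ r := by exact_mod_cast hr1
      nlinarith

include hρ in
/-- the bound for the sum of the last two Jucys-Murphy operators -/
lemma AA_le (c d : α) (hcd : d ≠ c) (r : ℕ) (v : V) (hv : v ∈ KK ρ Finset.univ r) :
    inner ℝ ((JM ρ Finset.univ c + JM ρ (Finset.univ.erase c) d) v) v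
      ≤ (2 * (r : ℝ) - 5) * ‖v‖ ^ 2 := by
  have hd : d ∈ (Finset.univ : Finset α).erase c := by simp [hcd]
  have hm1 : ∀ v ∈ KK ρ Finset.univ r, JM ρ Finset.univ c v ∈ KK ρ Finset.univ r :=
    fun v hv => JM_mem ρ hρ (Finset.subset_univ _) (Finset.mem_univ c) hv
  have hm2 : ∀ v ∈ KK ρ Finset.univ r, JM ρ (Finset.univ.erase c) d v ∈ KK ρ Finset.univ r :=
    fun v hv => JM_mem ρ hρ (Finset.subset_univ _) (Finset.mem_univ d) hv
  by_contra hcon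
  push Not at hcon
  obtain ⟨μ, w, hwK, hw0, hwb, hb⟩ := exists_eig_gt_inv _
    ((JM_symm ρ hρ Finset.univ c).add (JM_symm ρ hρ (Finset.univ.erase c) d)) (KK ρ Finset.univ r)
    (fun v hv => by
      rw [LinearMap.add_apply]
      exact Submodule.add_mem _ (hm1 v hv) (hm2 v hv)) _ v hv hcon
  obtain ⟨x, u, huK, hu0, huA, hux⟩ := exists_joint _ (JM ρ Finset.univ c) (JM_symm ρ hρ _ _)
    (fun v => by
      rw [LinearMap.add_apply, LinearMap.add_apply, map_add, JM_comm ρ hd]) _ hm1 μ w hwK hw0 hwb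
  have huy : JM ρ (Finset.univ.erase c) d u = (μ - x) • u := by
    rw [LinearMap.add_apply, hux] at huA
    rw [sub_smul, ← huA]; simp
  have hp : 0 < ‖u‖ ^ 2 := by positivity
  have h1 := JM_le ρ hρ _ Finset.univ rfl c (Finset.mem_univ c) r u huK
  have h2 := JM_le ρ hρ _ _ rfl d hd r u (KK_mono ρ (Finset.subset_univ _) r huK)
  rw [hux, inner_smul_left, real_inner_self_eq_norm_sq] at h1
  rw [huy, inner_smul_left, real_inner_self_eq_norm_sq] at h2
  have h1' := le_of_mul_le_mul_right h1 hp
  have h2' := le_of_mul_le_mul_right h2 hp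
  have h3 := pair_sep ρ hρ (Finset.mem_univ c) hd hu0 hux huy
  simp only [conj_trivial] at h1' h2'
  rcases le_abs'.1 h3 with h | h <;> linarith
end rep2

section conc
set_option linter.unusedSectionVars false
set_option linter.unusedVariables false
variable {α : Type*} [Fintype α] [DecidableEq α]
open Equiv

lemma rho_inv_of_swaps {V : Type*} [NormedAddCommGroup V] [InnerProductSpace ℝ V]
    [FiniteDimensional ℝ V] (ρ : Perm α →* Module.End ℝ V)
    {Z : Finset α} {u : V} (hu : ∀ i ∈ Z, ∀ j ∈ Z, ρ (swap i j) u = u) :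
    ∀ (s : ℕ) (π : Perm α), π.support.card = s → (∀ x, x ∉ Z → π x = x) → ρ π u = u := by
  intro s
  induction s using Nat.strong_induction_on with
  | _ s ih =>
    intro π hs hπ
    by_cases h1 : π = 1
    · rw [h1, map_one]; rfl
    obtain ⟨x, hx⟩ : ∃ x, π x ≠ x := by
      by_contra hcon
      push Not at hcon
      exact h1 (Equiv.ext hcon)
    have hxZ : x ∈ Z := by
      by_contra h; exact hx (hπ x h)
    have hpxZ : π x ∈ Z := by
      by_contra h; exact hx (π.injective (hπ _ h))
    have h2 := ih _ (hs ▸ Perm.card_support_swap_mul hx) (swap x (π x) * π) rfl (by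
      intro y hy
      rw [Perm.mul_apply, hπ y hy, swap_apply_of_ne_of_ne]
      · rintro rfl; exact hy hxZ
      · rintro rfl; exact hy hpxZ)
    rw [← rho_mul] at h2
    have h3 := congrArg (ρ (swap x (π x))) h2
    rw [swap_swap_rho, hu x hxZ _ hpxZ] at h3
    exact h3

/-- real valued character -/
noncomputable def chr (χ : Perm α →* ℤˣ) (g : Perm α) : ℝ := ((χ g : ℤ) : ℝ)

lemma chr_mul (χ : Perm α →* ℤˣ) (g h : Perm α) : chr χ (g * h) = chr χ g * chr χ h := by
  simp [chr]

lemma chr_self (χ : Perm α →* ℤˣ) (g : Perm α) : chr χ g * chr χ g = 1 := by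
  rcases Int.units_eq_one_or (χ g) with h | h <;> simp [chr, h]

/-- twisted right regular representation -/
noncomputable def rr (χ : Perm α →* ℤˣ) : Perm α →* Module.End ℝ (EuclideanSpace ℝ (Perm α)) where
  toFun g :=
    { toFun := fun f => WithLp.toLp 2 (fun σ => chr χ g * f (σ * g))
      map_add' := by intro x y; ext σ; simp [mul_add]
      map_smul' := by intro x y; ext σ; simp; ring }
  map_one' := by ext f σ; simp [chr]
  map_mul' := by
    intro g h
    apply LinearMap.ext
    intro f
    ext σ
    simp [chr_mul, mul_assoc]

lemma rr_apply (χ : Perm α →* ℤˣ) (g : Perm α) (f : EuclideanSpace ℝ (Perm α)) (σ : Perm α) :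
    rr χ g f σ = chr χ g * f (σ * g) := rfl

lemma inner_eq (f h : EuclideanSpace ℝ (Perm α)) : inner ℝ f h = ∑ σ, f σ * h σ := by
  rw [PiLp.inner_apply]
  exact Finset.sum_congr rfl fun i _ => by simp [mul_comm]

lemma rr_inner (χ : Perm α →* ℤˣ) (g : Perm α) (x y : EuclideanSpace ℝ (Perm α)) :
    inner ℝ (rr χ g x) (rr χ g y) = inner ℝ x y := by
  rw [inner_eq, inner_eq, ← Equiv.sum_comp (Equiv.mulRight g) (fun σ => x σ * y σ)]
  refine Finset.sum_congr rfl fun σ _ => ?_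
  rw [rr_apply, rr_apply, Equiv.coe_mulRight]
  linear_combination (x (σ * g) * y (σ * g)) * chr_self χ g

/-- restriction of a permutation to the complement of `Z` -/
def restr (Z : Finset α) (σ : Perm α) : {x // x ∉ Z} ↪ α :=
  (Function.Embedding.subtype _).trans σ.toEmbedding

noncomputable def uvec (χ : Perm α →* ℤˣ) (Z : Finset α) (e : {x // x ∉ Z} ↪ α) :
    EuclideanSpace ℝ (Perm α) :=
  WithLp.toLp 2 (fun σ => if restr Z σ = e then chr χ σ else 0)

lemma inv_mem_span (χ : Perm α →* ℤˣ) (Z : Finset α) (f : EuclideanSpace ℝ (Perm α))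
    (hf : ∀ i ∈ Z, ∀ j ∈ Z, rr χ (swap i j) f = f) :
    f ∈ Submodule.span ℝ (Set.range (uvec χ Z)) := by
  have hinv := fun π => rho_inv_of_swaps (rr χ) hf _ π rfl
  have hconst : ∀ σ σ', restr Z σ = restr Z σ' → chr χ σ * f σ = chr χ σ' * f σ' := by
    intro σ σ' h
    have h1 := hinv (σ⁻¹ * σ') (by
      intro x hx
      have := congrArg (fun e => e ⟨x, hx⟩) h
      simp only [restr, Function.Embedding.trans_apply, Function.Embedding.subtype_apply,
        Equiv.coe_toEmbedding] at this
      rw [Perm.mul_apply, ← this]; simp)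
    have h2 := congrArg (fun v : EuclideanSpace ℝ (Perm α) => v σ) h1
    simp only [rr_apply, mul_inv_cancel_left] at h2
    have h3 : chr χ (σ * (σ⁻¹ * σ')) = chr χ σ * chr χ (σ⁻¹ * σ') := chr_mul _ _ _
    rw [mul_inv_cancel_left] at h3
    rw [← h2, h3]; ring
  have hsum : f = ∑ e : {x // x ∉ Z} ↪ α,
      (if h : ∃ σ, restr Z σ = e then chr χ h.choose * f h.choose else 0) • uvec χ Z e := by
    ext σ
    rw [WithLp.ofLp_sum, Finset.sum_apply, Finset.sum_eq_single (restr Z σ)]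
    · have hex : ∃ σ', restr Z σ' = restr Z σ := ⟨σ, rfl⟩
      rw [dif_pos hex, hconst _ σ hex.choose_spec]
      simp only [uvec, PiLp.smul_apply, smul_eq_mul, if_true]
      linear_combination (- f σ) * chr_self χ σ
    · intro e _ he
      have h0 : uvec χ Z e σ = 0 := if_neg he.symm
      rw [PiLp.smul_apply, h0, smul_zero]
    · simp
  rw [hsum]
  exact Submodule.sum_mem _ fun e _ => Submodule.smul_mem _ _ (Submodule.subset_span ⟨e, rfl⟩)

lemma KK_codim (χ : Perm α →* ℤˣ) (r : ℕ) (hr : r ≤ Fintype.card α) :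
    Fintype.card (Perm α) ≤ Module.finrank ℝ (KK (rr χ) Finset.univ r)
      + (Fintype.card α).choose r * (Fintype.card α).descFactorial (Fintype.card α - r) := by
  let I := Σ Z : {Z // Z ∈ Finset.powersetCard r (Finset.univ : Finset α)},
    ({x // x ∉ Z.1} ↪ α)
  let S := Submodule.span ℝ (Set.range (fun i : I => uvec χ i.1.1 i.2))
  have h1 : Sᗮ ≤ KK (rr χ) Finset.univ r := by
    intro v hv Z _ hZ u hu
    have : u ∈ S := by
      refine Submodule.span_mono ?_ (inv_mem_span χ Z u hu)
      rintro _ ⟨e, rfl⟩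
      exact ⟨⟨⟨Z, by simp [hZ]⟩, e⟩, rfl⟩
    exact hv u this
  have h2 := Submodule.finrank_mono h1
  have h3 := Submodule.finrank_add_finrank_orthogonal S
  have h4 : Module.finrank ℝ S ≤ Fintype.card I := finrank_range_le_card _
  have h5 : Fintype.card I = (Fintype.card α).choose r *
      (Fintype.card α).descFactorial (Fintype.card α - r) := by
    rw [Fintype.card_sigma]
    rw [Finset.sum_congr rfl (g := fun _ => (Fintype.card α).descFactorial (Fintype.card α - r))]
    · simp
    · rintro ⟨Z, hZ⟩ _
      rw [Fintype.card_embedding_eq]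
      congr 1
      rw [Finset.mem_powersetCard] at hZ
      rw [Fintype.card_subtype_compl, Fintype.card_coe, hZ.2]
  rw [finrank_euclideanSpace] at h3
  omega
end conc

section eigsum
variable {α : Type*} [Fintype α] [DecidableEq α]
open Equiv

/-- sum over all transpositions meeting `{c, d}`, acting by right translation -/
noncomputable def AA (χ : Perm α →* ℤˣ) (c d : α) :
    EuclideanSpace ℝ (Perm α) →ₗ[ℝ] EuclideanSpace ℝ (Perm α) :=
  JM (rr χ) Finset.univ c + JM (rr χ) (Finset.univ.erase c) d

lemma AA_symm (χ : Perm α →* ℤˣ) (c d : α) : (AA χ c d).IsSymmetric :=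
  (JM_symm _ (rr_inner χ) _ _).add (JM_symm _ (rr_inner χ) _ _)

lemma JM_sign (B : Finset α) (c : α) (f : EuclideanSpace ℝ (Perm α)) :
    JM (rr Perm.sign) B c f = - JM (rr 1) B c f := by
  rw [JM_apply, JM_apply, ← Finset.sum_neg_distrib]
  refine Finset.sum_congr rfl fun i hi => ?_
  ext σ
  rw [PiLp.neg_apply, rr_apply, rr_apply]
  simp [chr, Perm.sign_swap (Finset.ne_of_mem_erase hi)]

lemma AA_sign (c d : α) (f : EuclideanSpace ℝ (Perm α)) :
    AA Perm.sign c d f = - AA 1 c d f := by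
  simp only [AA, LinearMap.add_apply, JM_sign]
  rw [neg_add]

lemma AA_form_le (c d : α) (hcd : d ≠ c) (e : ℝ) (he : e = 1 ∨ e = -1) (r : ℕ) :
    ∃ K : Submodule ℝ (EuclideanSpace ℝ (Perm α)),
      (∀ v ∈ K, e * inner ℝ (AA 1 c d v) v ≤ (2 * (r : ℝ) - 5) * ‖v‖ ^ 2) ∧
      (r ≤ Fintype.card α → Fintype.card (Perm α) ≤ Module.finrank ℝ K
      + (Fintype.card α).choose r * (Fintype.card α).descFactorial (Fintype.card α - r)) ∧
      (Fintype.card α < r → K = ⊤) := by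
  have htop : ∀ χ : Perm α →* ℤˣ, Fintype.card α < r → KK (rr χ) Finset.univ r = ⊤ := by
    intro χ h
    rw [eq_top_iff]
    intro v _ Z _ hZ
    have := Finset.card_le_univ Z
    omega
  rcases he with rfl | rfl
  · refine ⟨KK (rr 1) Finset.univ r, ?_, KK_codim _ _, htop _⟩
    intro v hv
    rw [one_mul]
    exact AA_le _ (rr_inner 1) c d hcd r v hv
  · refine ⟨KK (rr Perm.sign) Finset.univ r, ?_, KK_codim _ _, htop _⟩
    intro v hv
    have := AA_le _ (rr_inner Perm.sign) c d hcd r v hv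
    change inner ℝ (AA Perm.sign c d v) v ≤ _ at this
    rw [AA_sign, inner_neg_left] at this
    linarith

lemma eig_le (c d : α) (hcd : d ≠ c) (e : ℝ) (he : e = 1 ∨ e = -1) {N : ℕ}
    (hN : Module.finrank ℝ (EuclideanSpace ℝ (Perm α)) = N) (i : Fin N) :
    e * (AA_symm 1 c d).eigenvalues hN i ≤ 2 * (Fintype.card α : ℝ) - 3 := by
  obtain ⟨K, h1, -, h3⟩ := AA_form_le c d hcd e he (Fintype.card α + 1)
  have hK := h3 (Nat.lt_succ_self _)
  subst hK
  have h4 := count_eig (AA 1 c d) (AA_symm 1 c d) hN e ⊤ _ h1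
  rw [finrank_top, hN] at h4
  have h5 : (Finset.univ.filter (fun i => 2 * ((Fintype.card α + 1 : ℕ) : ℝ) - 5 <
    e * (AA_symm 1 c d).eigenvalues hN i)).card = 0 := by omega
  rw [Finset.card_eq_zero, Finset.filter_eq_empty_iff] at h5
  have := h5 (Finset.mem_univ i)
  push_cast at this
  linarith

lemma eig_count (c d : α) (hcd : d ≠ c) (e : ℝ) (he : e = 1 ∨ e = -1) {N : ℕ}
    (hN : Module.finrank ℝ (EuclideanSpace ℝ (Perm α)) = N) (q : ℕ) (hq : q ≤ Fintype.card α) :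
    ((Finset.univ.filter (fun i => 2 * (Fintype.card α : ℝ) - 3 - 2 * (q + 1) <
      e * (AA_symm 1 c d).eigenvalues hN i)).card : ℝ)
      ≤ ((Fintype.card α : ℝ) ^ 2) ^ q / q.factorial := by
  obtain ⟨K, h1, h2, -⟩ := AA_form_le c d hcd e he (Fintype.card α - q)
  have h4 := count_eig (AA 1 c d) (AA_symm 1 c d) hN e K _ h1
  have h2 := h2 (Nat.sub_le _ _)
  have hr : 2 * ((Fintype.card α - q : ℕ) : ℝ) - 5 = 2 * (Fintype.card α : ℝ) - 3 - 2 * (q + 1) := by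
    rw [Nat.cast_sub hq]; ring
  rw [hr] at h4
  have hN' : Fintype.card (Perm α) = N := by rw [← hN, finrank_euclideanSpace]
  rw [Nat.choose_symm hq, Nat.sub_sub_self hq] at h2
  have h5 : (Finset.univ.filter (fun i => 2 * (Fintype.card α : ℝ) - 3 - 2 * (q + 1) <
      e * (AA_symm 1 c d).eigenvalues hN i)).card
      ≤ (Fintype.card α).choose q * (Fintype.card α).descFactorial q := by omega
  calc _ ≤ (((Fintype.card α).choose q * (Fintype.card α).descFactorial q : ℕ) : ℝ) := by
        exact_mod_cast h5
    _ ≤ ((Fintype.card α : ℝ) ^ q / q.factorial) * (Fintype.card α : ℝ) ^ q := by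
        push_cast
        refine mul_le_mul (Nat.choose_le_pow_div _ _) ?_ (by positivity) (by positivity)
        exact_mod_cast Nat.descFactorial_le_pow _ _
    _ = _ := by rw [← pow_mul, two_mul, pow_add]; ring

lemma eig_sum (c d : α) (hcd : d ≠ c) {N : ℕ}
    (hN : Module.finrank ℝ (EuclideanSpace ℝ (Perm α)) = N) (h3 : 3 ≤ Fintype.card α) (k : ℕ) :
    ∑ i, ((AA_symm 1 c d).eigenvalues hN i / (2 * (Fintype.card α : ℝ) - 3)) ^ (2 * k)
      ≤ 2 * Real.exp ((Fintype.card α : ℝ) ^ 2 *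
        Real.exp (- (4 * k / (2 * (Fintype.card α : ℝ) - 3)))) := by
  set n := Fintype.card α with hn
  set L : ℝ := 2 * (n : ℝ) - 3 with hL
  set μ := (AA_symm 1 c d).eigenvalues hN with hμ
  have hn3 : (3 : ℝ) ≤ n := by exact_mod_cast h3
  have hLpos : 0 < L := by rw [hL]; linarith
  set y := Real.exp (- (4 * k / L)) with hy
  have key : ∀ i, (μ i / L) ^ (2 * k) ≤ ∑ q ∈ Finset.range n,
      ((if L - 2 * (q + 1) < 1 * μ i then y ^ q else 0)
        + (if L - 2 * (q + 1) < (-1) * μ i then y ^ q else 0)) := by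
    intro i
    have hab : |μ i| ≤ L := by
      have h1 := eig_le c d hcd 1 (Or.inl rfl) hN i
      have h2 := eig_le c d hcd (-1) (Or.inr rfl) hN i
      rw [abs_le]; constructor <;> linarith
    set q := ⌊(L - |μ i|) / 2⌋₊ with hq
    have hq1 : (q : ℝ) ≤ (L - |μ i|) / 2 := Nat.floor_le (by linarith)
    have hq2 : (L - |μ i|) / 2 < q + 1 := Nat.lt_floor_add_one _
    have hqn : q < n := by
      have : (q : ℝ) < n := by
        have := abs_nonneg (μ i)
        linarith
      exact_mod_cast this
    have hterm : (μ i / L) ^ (2 * k) ≤ y ^ q := by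
      have e1 : (μ i / L) ^ (2 * k) = (|μ i| / L) ^ (2 * k) := by
        rw [pow_mul, pow_mul, div_pow _ _ 2, div_pow (|μ i|) _ 2, sq_abs]
      have e2 : |μ i| / L ≤ Real.exp (- (2 * q / L)) := by
        refine le_trans ?_ (Real.add_one_le_exp _)
        rw [div_le_iff₀ hLpos, add_mul, neg_mul, div_mul_cancel₀ _ hLpos.ne']
        linarith
      rw [e1]
      refine (pow_le_pow_left₀ (by positivity) e2 _).trans (le_of_eq ?_)
      rw [hy, ← Real.exp_nat_mul, ← Real.exp_nat_mul]
      congr 1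
      push_cast
      ring
    have hyp : ∀ q : ℕ, 0 ≤ y ^ q := fun q => by positivity
    refine le_trans ?_ (Finset.single_le_sum (fun q _ => ?_) (Finset.mem_range.2 hqn))
    · rcases abs_cases (μ i) with ⟨h, _⟩ | ⟨h, _⟩
      · rw [if_pos (show L - 2 * ((q : ℝ) + 1) < 1 * μ i by linarith)]
        have : 0 ≤ (if L - 2 * ((q : ℝ) + 1) < (-1) * μ i then y ^ q else 0) := by
          split_ifs; exacts [hyp q, le_rfl]
        linarith
      · rw [if_pos (show L - 2 * ((q : ℝ) + 1) < (-1) * μ i by linarith)]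
        have : 0 ≤ (if L - 2 * ((q : ℝ) + 1) < 1 * μ i then y ^ q else 0) := by
          split_ifs; exacts [hyp q, le_rfl]
        linarith
    · have := hyp q
      positivity
  refine (Finset.sum_le_sum fun i _ => key i).trans ?_
  rw [Finset.sum_comm]
  have hcnt : ∀ e : ℝ, (e = 1 ∨ e = -1) → ∀ q ∈ Finset.range n,
      ∑ i, (if L - 2 * ((q : ℝ) + 1) < e * μ i then y ^ q else 0)
        ≤ ((n : ℝ) ^ 2 * y) ^ q / q.factorial := by
    intro e he q hq
    rw [← Finset.sum_filter, Finset.sum_const, nsmul_eq_mul]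
    have := eig_count c d hcd e he hN q (Finset.mem_range.1 hq).le
    rw [mul_pow, mul_div_right_comm]
    exact mul_le_mul_of_nonneg_right this (by positivity)
  calc _ ≤ ∑ q ∈ Finset.range n, 2 * (((n : ℝ) ^ 2 * y) ^ q / q.factorial) := by
        refine Finset.sum_le_sum fun q hq => ?_
        rw [Finset.sum_add_distrib]
        exact (add_le_add (hcnt 1 (Or.inl rfl) q hq) (hcnt (-1) (Or.inr rfl) q hq)).trans
          (le_of_eq (two_mul _).symm)
    _ ≤ _ := by
        rw [← Finset.mul_sum]
        exact mul_le_mul_of_nonneg_left (Real.sum_le_exp_of_nonneg (by positivity) n) (by norm_num)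
end eigsum

section gens
variable {α : Type*} [Fintype α] [DecidableEq α]
open Equiv

/-- the support of the measure `P` -/
def TT (c d : α) : Finset (Perm α) :=
  ((Finset.univ.erase c).image (fun i => swap i c * swap d c)) ∪
    (((Finset.univ.erase c).erase d).image (fun i => swap i d * swap d c))

lemma mem_TT {c d : α} (hcd : d ≠ c) (x : Perm α) :
    x ∈ TT c d ↔ x = 1 ∨ (x.IsThreeCycle ∧ c ∈ x.support ∧ d ∈ x.support) := by
  simp only [TT, Finset.mem_union, Finset.mem_image, Finset.mem_erase, Finset.mem_univ, and_true]
  constructor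
  · rintro (⟨i, hi, rfl⟩ | ⟨i, ⟨hid, hic⟩, rfl⟩)
    · by_cases hid : i = d
      · left; rw [hid, swap_mul_self]
      · right
        refine ⟨?_, ?_, ?_⟩
        · rw [swap_comm i c, swap_comm d c]
          exact Perm.isThreeCycle_swap_mul_swap_same (Ne.symm hi) (Ne.symm hcd) hid
        · rw [Perm.mem_support, Perm.mul_apply, swap_apply_right,
            swap_apply_of_ne_of_ne (Ne.symm hid) hcd]
          exact hcd
        · rw [Perm.mem_support, Perm.mul_apply, swap_apply_left, swap_apply_right]
          exact hid
    · right
      refine ⟨?_, ?_, ?_⟩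
      · rw [swap_comm i d]
        exact Perm.isThreeCycle_swap_mul_swap_same (Ne.symm hid) hcd hic
      · rw [Perm.mem_support, Perm.mul_apply, swap_apply_right, swap_apply_right]
        exact hic
      · rw [Perm.mem_support, Perm.mul_apply, swap_apply_left,
          swap_apply_of_ne_of_ne (Ne.symm hic) (Ne.symm hcd)]
        exact Ne.symm hcd
  · rintro (rfl | ⟨h3, hc, hd⟩)
    · left; exact ⟨d, hcd, swap_mul_self _ _⟩
    · have hcube : ∀ y, x (x (x y)) = y := by
        intro y
        have h : x ^ 3 = 1 := by rw [← h3.orderOf]; exact pow_orderOf_eq_one x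
        have := congrArg (fun g => g y) h
        simpa [pow_succ, Perm.mul_apply] using this
      have hcard := h3.card_support
      rw [Perm.mem_support] at hc hd
      have hout : ∀ f, x f ≠ f → f ≠ c → f ≠ d → ∀ y, y ≠ c → y ≠ d → y ≠ f → x y = y := by
        intro f hf hfc hfd y h1 h2 h3
        by_contra hy
        have hsub : ({c, d, f, y} : Finset α) ⊆ x.support := by
          intro z hz
          simp only [Finset.mem_insert, Finset.mem_singleton] at hz
          rw [Perm.mem_support]
          rcases hz with rfl | rfl | rfl | rfl <;> assumption
        have h4 := Finset.card_le_card hsub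
        rw [hcard, Finset.card_insert_of_notMem (by simp [hcd.symm, hfc.symm, h1.symm]),
          Finset.card_insert_of_notMem (by simp [hfd.symm, h2.symm]),
          Finset.card_insert_of_notMem (by simp [h3.symm])] at h4
        simp at h4
      by_cases hdc : x d = c
      · right
        have hcf : x c ≠ d := by
          intro h
          have := hcube d
          rw [hdc, h, hdc] at this
          exact hcd this.symm
        have hxf : x (x c) = d := by have := hcube d; rwa [hdc] at this
        refine ⟨x c, ⟨hcf, hc⟩, ?_⟩
        have ho := hout (x c) (fun h => hc (x.injective h)) hc hcf
        ext1 y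
        rw [Perm.mul_apply]
        by_cases h1 : y = c
        · subst h1; simp
        by_cases h2 : y = d
        · subst h2
          rw [swap_apply_left, swap_apply_of_ne_of_ne hc.symm (Ne.symm hcd), hdc]
        rw [swap_apply_of_ne_of_ne h2 h1]
        by_cases h3 : y = x c
        · subst h3; rw [swap_apply_left, hxf]
        · rw [swap_apply_of_ne_of_ne h3 h2, ho y h1 h2 h3]
      · left
        have hne : x (x d) ≠ x d := fun h => hd (x.injective h)
        have hnd : x (x d) ≠ d := by
          intro h
          have := hcube d
          rw [h] at this; exact hd this
        have hxx : x (x d) = c := by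
          by_contra hcon
          have := hout (x d) hne hdc hd (x (x d)) hcon hnd hne
          exact hne (x.injective this)
        have hxc : x c = d := by rw [← hxx]; exact hcube d
        refine ⟨x d, hdc, ?_⟩
        have ho := hout (x d) hne hdc hd
        ext1 y
        rw [Perm.mul_apply]
        by_cases h1 : y = c
        · subst h1; rw [swap_apply_right, swap_apply_of_ne_of_ne hd.symm hcd, hxc]
        by_cases h2 : y = d
        · subst h2; rw [swap_apply_left, swap_apply_right]
        rw [swap_apply_of_ne_of_ne h2 h1]
        by_cases h3 : y = x d
        · subst h3; rw [swap_apply_left, hxx]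
        · rw [swap_apply_of_ne_of_ne h3 h1, ho y h1 h2 h3]

lemma sum_TT {c d : α} (hcd : d ≠ c) (h : Perm α → ℝ) :
    ∑ g ∈ TT c d, h g = ∑ i ∈ Finset.univ.erase c, h (swap i c * swap d c) +
      ∑ i ∈ (Finset.univ.erase c).erase d, h (swap i d * swap d c) := by
  rw [TT, Finset.sum_union, Finset.sum_image, Finset.sum_image]
  · intro i hi j hj hij
    have := congrArg (fun g => g d) (mul_right_cancel hij)
    simpa using this
  · intro i hi j hj hij
    have := congrArg (fun g => g c) (mul_right_cancel hij)
    simpa using this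
  · rw [Finset.disjoint_left]
    rintro _ h1 h2
    obtain ⟨i, hi, rfl⟩ := Finset.mem_image.1 h1
    obtain ⟨j, hj, hij⟩ := Finset.mem_image.1 h2
    have h3 := congrArg (fun g => g c) (mul_right_cancel hij)
    simp only [swap_apply_right] at h3
    simp only [Finset.mem_erase, Finset.mem_univ, and_true] at hi hj
    rw [swap_apply_of_ne_of_ne (Ne.symm hj.2) (Ne.symm hcd)] at h3
    exact hi h3.symm

lemma TT_even {c d : α} (hcd : d ≠ c) {x : Perm α} (hx : x ∈ TT c d) : x ∈ alternatingGroup α := by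
  rw [mem_TT hcd] at hx
  rcases hx with rfl | ⟨h, -⟩
  · exact one_mem _
  · exact h.mem_alternatingGroup

lemma card_TT {c d : α} (hcd : d ≠ c) (hn : 2 ≤ Fintype.card α) :
    ((TT c d).card : ℝ) = 2 * (Fintype.card α : ℝ) - 3 := by
  have := sum_TT hcd (fun _ => 1)
  simp only [Finset.sum_const, nsmul_eq_mul, mul_one] at this
  rw [this, Finset.card_erase_of_mem (a := d) (Finset.mem_erase.2 ⟨hcd, Finset.mem_univ _⟩),
    Finset.card_erase_of_mem (Finset.mem_univ c),
    Finset.card_univ, Nat.sub_sub, Nat.cast_sub (by omega), Nat.cast_sub (by omega)]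
  push_cast; ring
end gens

section PP
open Equiv

/-- the last point -/
def pc (n : ℕ) (hn : 3 ≤ n) : Fin n := ⟨n - 1, by omega⟩
/-- the point before the last -/
def pd (n : ℕ) (hn : 3 ≤ n) : Fin n := ⟨n - 2, by omega⟩

lemma pdc (n : ℕ) (hn : 3 ≤ n) : pd n hn ≠ pc n hn := by
  simp only [pd, pc, ne_eq, Fin.mk.injEq]; omega

lemma Pmeas_eq (n : ℕ) (hn : 3 ≤ n) (x : alternatingGroup (Fin n)) :
    Pmeas n x = if (x : Perm (Fin n)) ∈ TT (pc n hn) (pd n hn) then 1 / (2 * (n : ℝ) - 3) else 0 := by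
  have hiff : (∀ y : Fin n, n - 2 ≤ (y : ℕ) → y ∈ (x : Perm (Fin n)).support) ↔
      (pc n hn ∈ (x : Perm (Fin n)).support ∧ pd n hn ∈ (x : Perm (Fin n)).support) := by
    constructor
    · intro h
      exact ⟨h _ (by simp only [pc]; omega), h _ (by simp [pd])⟩
    · rintro ⟨h1, h2⟩ y hy
      have : y = pc n hn ∨ y = pd n hn := by
        simp only [pc, pd, Fin.ext_iff]; omega
      rcases this with rfl | rfl <;> assumption
  rw [Pmeas]
  have hm := mem_TT (pdc n hn) (x : Perm (Fin n))
  by_cases h1 : (x : Perm (Fin n)) = 1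
  · rw [if_pos h1, if_pos (hm.2 (Or.inl h1))]
  · rw [if_neg h1]
    refine if_congr ?_ rfl rfl
    rw [hm, hiff]
    simp [h1]

lemma sum_alt {α : Type*} [Fintype α] [DecidableEq α] [Fintype (alternatingGroup α)] (F : Perm α → ℝ)
    (hF : ∀ g, g ∉ alternatingGroup α → F g = 0) :
    ∑ x : alternatingGroup α, F x = ∑ g, F g := by
  refine Finset.sum_of_injOn (fun x : alternatingGroup α => (x : Perm α)) ?_ ?_ ?_ ?_
  · intro x _ y _ h; exact Subtype.ext h
  · intro x _; simp
  · intro g _ hg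
    apply hF
    intro h
    exact hg ⟨⟨g, h⟩, by simp, rfl⟩
  · intro x _; rfl

lemma sum_Pmeas (n : ℕ) (hn : 3 ≤ n) (h : Perm (Fin n) → ℝ) :
    ∑ x : alternatingGroup (Fin n), Pmeas n x * h x =
      (∑ g ∈ TT (pc n hn) (pd n hn), h g) / (2 * (n : ℝ) - 3) := by
  have h1 : ∀ x : alternatingGroup (Fin n), Pmeas n x * h x =
      (fun g => if g ∈ TT (pc n hn) (pd n hn) then h g / (2 * (n : ℝ) - 3) else 0) x.1 := by
    intro x
    rw [Pmeas_eq n hn]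
    dsimp only
    split_ifs <;> ring
  rw [Finset.sum_congr rfl fun x _ => h1 x]
  refine (sum_alt (fun g => if g ∈ TT (pc n hn) (pd n hn) then h g / (2 * (n : ℝ) - 3) else 0) ?_).trans ?_
  rotate_left
  · rw [← Finset.sum_filter, Finset.sum_div]
    refine Finset.sum_congr ?_ fun _ _ => rfl
    ext g; simp
  · intro g hg
    exact if_neg fun h => hg (TT_even (pdc n hn) h)

lemma sum_convolve {G : Type*} [Group G] [Fintype G] (p q h : G → ℝ) :
    ∑ x, convolve p q x * h x = ∑ g, p g * ∑ y, q y * h (g * y) := by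
  simp only [convolve, Finset.sum_mul, Finset.mul_sum]
  rw [Finset.sum_comm]
  refine Finset.sum_congr rfl fun g _ => ?_
  rw [← Equiv.sum_comp (Equiv.mulLeft g)]
  refine Finset.sum_congr rfl fun y _ => ?_
  simp [mul_assoc]

lemma sum_convPow {G : Type*} [Group G] [Fintype G] (p : G → ℝ) (hp : ∑ x, p x = 1) (k : ℕ) :
    ∑ x, convPow p k x = 1 := by
  induction k with
  | zero => simp [convPow]
  | succ k ih =>
    have := sum_convolve (convPow p k) p (fun _ => 1)
    simp only [mul_one, hp] at this
    rw [convPow, this, ih]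

lemma convPow_nonneg {G : Type*} [Group G] [Fintype G] (p : G → ℝ) (hp : ∀ x, 0 ≤ p x) (k : ℕ) :
    ∀ x, 0 ≤ convPow p k x := by
  induction k with
  | zero => intro x; simp only [convPow]; split_ifs <;> norm_num
  | succ k ih =>
    intro x
    exact Finset.sum_nonneg fun g _ => mul_nonneg (ih g) (hp _)

lemma Lpos (n : ℕ) (hn : 3 ≤ n) : 0 < 2 * (n : ℝ) - 3 := by
  have : (3 : ℝ) ≤ n := by exact_mod_cast hn
  linarith

lemma Pmeas_sum (n : ℕ) (hn : 3 ≤ n) : ∑ x, Pmeas n x = 1 := by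
  have h := sum_Pmeas n hn (fun _ => 1)
  simp only [mul_one, Finset.sum_const, nsmul_eq_mul] at h
  rw [h, card_TT (pdc n hn) (by rw [Fintype.card_fin]; omega), Fintype.card_fin,
    div_self (Lpos n hn).ne']

lemma Pmeas_nonneg (n : ℕ) (hn : 3 ≤ n) (x) : 0 ≤ Pmeas n x := by
  rw [Pmeas_eq n hn]
  have := Lpos n hn
  split_ifs <;> positivity
end PP

section upper
open Equiv

section gen
variable {α : Type*} [Fintype α] [DecidableEq α]

lemma rr_one_apply (g : Perm α) (f : EuclideanSpace ℝ (Perm α)) (σ : Perm α) :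
    rr 1 g f σ = f (σ * g) := by
  rw [rr_apply]; simp [chr]

lemma AA_apply (c d : α) (f : EuclideanSpace ℝ (Perm α)) (σ : Perm α) :
    AA 1 c d f σ = ∑ i ∈ Finset.univ.erase c, f (σ * swap i c) +
      ∑ i ∈ (Finset.univ.erase c).erase d, f (σ * swap i d) := by
  rw [AA, LinearMap.add_apply, PiLp.add_apply, JM_apply, JM_apply, WithLp.ofLp_sum, WithLp.ofLp_sum,
    Finset.sum_apply, Finset.sum_apply]
  simp only [rr_one_apply]

lemma AA_tau (c d : α) (hcd : d ≠ c) (f : EuclideanSpace ℝ (Perm α)) :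
    AA 1 c d (rr 1 (swap d c) f) = rr 1 (swap d c) (AA 1 c d f) := by
  have hm : d ∈ Finset.univ.erase c := by simp [hcd]
  have h1 := JM_tau (rr (1 : Perm α →* ℤˣ)) hm f
  have h2 := JM_tau (rr (1 : Perm α →* ℤˣ)) hm (rr 1 (swap d c) f)
  rw [swap_swap_rho] at h2
  have h3 := congrArg (rr (1 : Perm α →* ℤˣ) (swap d c)) h2
  rw [map_add, swap_swap_rho, swap_swap_rho] at h3
  rw [AA, LinearMap.add_apply, LinearMap.add_apply, map_add, h1, h3]
  abel

lemma AA_left (c d : α) (g : Perm α) (f f' : EuclideanSpace ℝ (Perm α))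
    (h : ∀ σ, f' (g * σ) = f σ) (k : ℕ) :
    ∀ σ, (AA 1 c d ^ k) f' (g * σ) = (AA 1 c d ^ k) f σ := by
  induction k with
  | zero => simpa using h
  | succ k ih =>
    intro σ
    rw [pow_succ', Module.End.mul_apply, Module.End.mul_apply, AA_apply, AA_apply]
    simp only [mul_assoc, ih]

lemma AA_norm_basis (c d : α) (k : ℕ) (g : Perm α) :
    ‖(AA 1 c d ^ k) (EuclideanSpace.single g 1)‖ ^ 2 =
      ‖(AA 1 c d ^ k) (EuclideanSpace.single (1 : Perm α) 1)‖ ^ 2 := by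
  rw [EuclideanSpace.real_norm_sq_eq, EuclideanSpace.real_norm_sq_eq,
    ← Equiv.sum_comp (Equiv.mulLeft g)]
  refine Finset.sum_congr rfl fun σ _ => ?_
  rw [Equiv.coe_mulLeft, AA_left c d g (EuclideanSpace.single (1 : Perm α) 1)]
  intro σ
  simp [Pi.single_apply]

lemma AA_norm (c d : α) (hcd : d ≠ c) (h3 : 3 ≤ Fintype.card α) (k : ℕ) :
    (Fintype.card (Perm α) : ℝ) * (‖(AA 1 c d ^ k) (EuclideanSpace.single (1 : Perm α) 1)‖ ^ 2 /
      (2 * (Fintype.card α : ℝ) - 3) ^ (2 * k)) ≤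
      2 * Real.exp ((Fintype.card α : ℝ) ^ 2 * Real.exp (-(4 * k / (2 * (Fintype.card α : ℝ) - 3)))) := by
  have h := hs_norm (AA 1 c d) (AA_symm 1 c d) rfl (EuclideanSpace.basisFun (Perm α) ℝ) k
  have h' := eig_sum c d hcd rfl h3 k
  simp only [div_pow] at h'
  rw [← Finset.sum_div, ← h] at h'
  simp only [EuclideanSpace.basisFun_apply, AA_norm_basis c d k] at h'
  rw [Finset.sum_const, nsmul_eq_mul, Finset.card_univ] at h'
  rwa [← mul_div_assoc]
end gen

/-- extension of a function on the alternating group by zero -/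
noncomputable def pext {n : ℕ} (p : alternatingGroup (Fin n) → ℝ) : EuclideanSpace ℝ (Perm (Fin n)) :=
  WithLp.toLp 2 (fun y => if h : y ∈ alternatingGroup (Fin n) then p ⟨y, h⟩ else 0)

lemma pext_apply {n : ℕ} (p : alternatingGroup (Fin n) → ℝ) (y : Perm (Fin n)) :
    pext p y = if h : y ∈ alternatingGroup (Fin n) then p ⟨y, h⟩ else 0 := rfl

lemma pext_coe {n : ℕ} (p : alternatingGroup (Fin n) → ℝ) (y : alternatingGroup (Fin n)) :
    pext p y = p y := by
  rw [pext_apply, dif_pos y.2]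

lemma pext_norm {n : ℕ} (p : alternatingGroup (Fin n) → ℝ) : ‖pext p‖ ^ 2 = ∑ x, p x ^ 2 := by
  rw [EuclideanSpace.real_norm_sq_eq, ← sum_alt]
  · exact Finset.sum_congr rfl fun x _ => by rw [pext_coe]
  · intro g hg
    rw [pext_apply, dif_neg hg]; simp

lemma pext_step (n : ℕ) (hn : 3 ≤ n) (k : ℕ) :
    pext (convPow (Pmeas n) (k + 1)) = (2 * (n : ℝ) - 3)⁻¹ •
      rr 1 (swap (pd n hn) (pc n hn)) (AA 1 (pc n hn) (pd n hn) (pext (convPow (Pmeas n) k))) := by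
  set c := pc n hn
  set d := pd n hn
  have hcd : d ≠ c := pdc n hn
  ext y
  rw [PiLp.smul_apply, rr_one_apply, AA_apply, smul_eq_mul]
  by_cases hy : y ∈ alternatingGroup (Fin n)
  · have h1 : pext (convPow (Pmeas n) (k + 1)) y =
        ∑ x : alternatingGroup (Fin n), Pmeas n x * pext (convPow (Pmeas n) k) (y * (x : Perm (Fin n))⁻¹) := by
      rw [pext_apply, dif_pos hy, convPow, convolve,
        ← Equiv.sum_comp ((Equiv.inv _).trans (Equiv.mulLeft (⟨y, hy⟩ : alternatingGroup (Fin n))))]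
      refine Finset.sum_congr rfl fun x _ => ?_
      have h2 : y * (x : Perm (Fin n))⁻¹ = ((⟨y, hy⟩ * x⁻¹ : alternatingGroup (Fin n)) : Perm (Fin n)) := rfl
      rw [h2, pext_coe]
      simp [mul_comm]
    rw [h1, sum_Pmeas n hn (fun x => pext (convPow (Pmeas n) k) (y * x⁻¹)), sum_TT hcd, div_eq_inv_mul]
    simp only [mul_inv_rev, swap_inv, mul_assoc]
  · rw [pext_apply, dif_neg hy]
    have h0 : ∀ i a, i ≠ a → pext (convPow (Pmeas n) k) (y * swap d c * swap i a) = 0 := by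
      intro i a hia
      rw [pext_apply, dif_neg]
      rw [Perm.mem_alternatingGroup] at hy ⊢
      rw [map_mul, map_mul, Perm.sign_swap hcd, Perm.sign_swap hia]
      simpa using hy
    rw [Finset.sum_eq_zero, Finset.sum_eq_zero]
    · simp
    · intro i hi; exact h0 i d (Finset.ne_of_mem_erase hi)
    · intro i hi; exact h0 i c (Finset.ne_of_mem_erase hi)

lemma pext_norm_pow (n : ℕ) (hn : 3 ≤ n) (k j : ℕ) :
    ‖(AA 1 (pc n hn) (pd n hn) ^ j) (pext (convPow (Pmeas n) k))‖ ^ 2 =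
      ‖(AA 1 (pc n hn) (pd n hn) ^ (j + k)) (EuclideanSpace.single (1 : Perm (Fin n)) 1)‖ ^ 2 /
        (2 * (n : ℝ) - 3) ^ (2 * k) := by
  have hL := Lpos n hn
  induction k generalizing j with
  | zero =>
    have : pext (convPow (Pmeas n) 0) = EuclideanSpace.single (1 : Perm (Fin n)) (1 : ℝ) := by
      ext y
      rw [pext_apply]
      by_cases hy : y = 1
      · subst hy; simp [convPow, one_mem]
      · simp [convPow, hy, Pi.single_apply]
    rw [this]; simp
  | succ k ih =>
    have hcomm : ∀ (j : ℕ) f, (AA 1 (pc n hn) (pd n hn) ^ j) (rr 1 (swap (pd n hn) (pc n hn)) f) =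
        rr 1 (swap (pd n hn) (pc n hn)) ((AA 1 (pc n hn) (pd n hn) ^ j) f) := by
      intro j
      induction j with
      | zero => intro f; simp
      | succ j ih' =>
        intro f
        rw [pow_succ, Module.End.mul_apply, Module.End.mul_apply, AA_tau _ _ (pdc n hn), ih']
    rw [pext_step n hn, map_smul, hcomm, norm_smul, norm_rho _ (rr_inner 1), ← Module.End.mul_apply,
      ← pow_succ, mul_pow, ih, Real.norm_of_nonneg (by positivity), show j + 1 + k = j + (k + 1) by ring]
    field_simp
    ring

lemma l2_bound (n : ℕ) (hn : 3 ≤ n) (k : ℕ) :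
    (n.factorial : ℝ) * ∑ x, convPow (Pmeas n) k x ^ 2 ≤
      2 * Real.exp ((n : ℝ) ^ 2 * Real.exp (-(4 * k / (2 * (n : ℝ) - 3)))) := by
  have h := AA_norm (pc n hn) (pd n hn) (pdc n hn) (by simpa using hn) k
  have h2 := pext_norm_pow n hn k 0
  simp only [pow_zero, Module.End.one_apply, zero_add] at h2
  rw [pext_norm] at h2
  rw [Fintype.card_perm, Fintype.card_fin, ← h2] at h
  exact h

lemma tv_upper (n : ℕ) (hn : 3 ≤ n) (k : ℕ) :
    tvDist (convPow (Pmeas n) k) (unif (alternatingGroup (Fin n))) ≤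
      Real.sqrt (Real.exp ((n : ℝ) ^ 2 * Real.exp (-(4 * k / (2 * (n : ℝ) - 3)))) - 1) := by
  set p := convPow (Pmeas n) k with hp
  have hsum : ∑ x, p x = 1 := sum_convPow _ (Pmeas_sum n hn) k
  have : Nontrivial (Fin n) := Fin.nontrivial_iff_two_le.2 (by omega)
  set N := Fintype.card (alternatingGroup (Fin n)) with hN
  have hcard : (2 : ℝ) * N = n.factorial := by
    have := two_mul_card_alternatingGroup (α := Fin n)
    rw [Fintype.card_perm, Fintype.card_fin] at this
    rw [← this, hN]
    push_cast
    congr 2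
  have hNpos : (0 : ℝ) < N := by
    have : (0 : ℝ) < n.factorial := by exact_mod_cast n.factorial_pos
    linarith
  have hl2 := l2_bound n hn k
  rw [← hcard, ← hp] at hl2
  have hcs : (∑ x, |p x - unif (alternatingGroup (Fin n)) x|) ^ 2 ≤
      N * ∑ x, (p x - unif (alternatingGroup (Fin n)) x) ^ 2 := by
    have := sq_sum_le_card_mul_sum_sq (s := Finset.univ)
      (f := fun x => |p x - unif (alternatingGroup (Fin n)) x|)
    simpa [sq_abs, hN] using this
  have hex : N * ∑ x, (p x - unif (alternatingGroup (Fin n)) x) ^ 2 = N * ∑ x, p x ^ 2 - 1 := by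
    simp only [unif, sub_sq, Finset.sum_add_distrib, Finset.sum_sub_distrib, ← Finset.sum_mul,
      ← Finset.mul_sum, hsum, Finset.sum_const, nsmul_eq_mul, Finset.card_univ, ← hN]
    field_simp
    ring
  have h0 : 0 ≤ ∑ x, |p x - unif (alternatingGroup (Fin n)) x| := Finset.sum_nonneg fun _ _ => abs_nonneg _
  rw [tvDist]
  apply Real.le_sqrt_of_sq_le
  rw [div_pow]
  nlinarith [sq_nonneg (∑ x, |p x - unif (alternatingGroup (Fin n)) x|)]

lemma tv_upper' (n : ℕ) (hn : 3 ≤ n) (c : ℝ) (hc : 0 ≤ c) :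
    tvDist (convPow (Pmeas n) ⌈((n : ℝ) - 3 / 2) * Real.log n + c * n⌉₊) (unif (alternatingGroup (Fin n))) ≤
      Real.sqrt (Real.exp (Real.exp (-(2 * c))) - 1) := by
  refine (tv_upper n hn _).trans (Real.sqrt_le_sqrt ?_)
  have hL := Lpos n hn
  have hn0 : (0 : ℝ) < n := by linarith
  set k := ⌈((n : ℝ) - 3 / 2) * Real.log n + c * n⌉₊
  have hk : ((n : ℝ) - 3 / 2) * Real.log n + c * n ≤ k := Nat.le_ceil _
  have h1 : 2 * Real.log n + 2 * c ≤ 4 * k / (2 * (n : ℝ) - 3) := by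
    rw [le_div_iff₀ hL]
    nlinarith
  have h2 : (n : ℝ) ^ 2 * Real.exp (-(4 * k / (2 * (n : ℝ) - 3))) ≤ Real.exp (-(2 * c)) := by
    calc (n : ℝ) ^ 2 * Real.exp (-(4 * k / (2 * (n : ℝ) - 3)))
        ≤ (n : ℝ) ^ 2 * Real.exp (-(2 * Real.log n + 2 * c)) := by gcongr
      _ = Real.exp (-(2 * c)) := by
        rw [neg_add, Real.exp_add, ← mul_assoc]
        have : Real.exp (-(2 * Real.log n)) = ((n : ℝ) ^ 2)⁻¹ := by
          rw [Real.exp_neg, two_mul, Real.exp_add, Real.exp_log hn0, sq]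
        rw [this, mul_inv_cancel₀ (by positivity), one_mul]
  gcongr
end upper

section lower
open Equiv

lemma sum_words {G : Type*} [Group G] [Fintype G] (p : G → ℝ) (k : ℕ) (h : G → ℝ) :
    ∑ x, convPow p k x * h x = ∑ w : Fin k → G, (∏ t, p (w t)) * h (List.ofFn w).prod := by
  induction k generalizing h with
  | zero => simp [convPow]
  | succ k ih =>
    rw [convPow, sum_convolve, ih (fun g => ∑ y, p y * h (g * y)),
      ← Equiv.sum_comp (Fin.snocEquiv (fun _ => G)), Fintype.sum_prod_type, Finset.sum_comm]
    refine Finset.sum_congr rfl fun w _ => ?_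
    rw [Finset.mul_sum]
    refine Finset.sum_congr rfl fun y _ => ?_
    rw [Fin.prod_univ_castSucc, List.ofFn_succ', List.concat_eq_append, List.prod_append]
    simp [Fin.snocEquiv, mul_assoc]

/-- indicator that `S` is fixed pointwise -/
noncomputable def fx {α : Type*} (S : Finset α) (x : Perm α) : ℝ :=
  if ∀ j ∈ S, x j = j then 1 else 0

lemma fx_nonneg {α : Type*} (S : Finset α) (x : Perm α) : 0 ≤ fx S x := by
  rw [fx]; split_ifs <;> norm_num

lemma fx_le {α : Type*} (S : Finset α) (x : Perm α) : fx S x ≤ 1 := by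
  rw [fx]; split_ifs <;> norm_num

lemma fx_mul {α : Type*} [DecidableEq α] (i j : α) (x : Perm α) :
    fx {i} x * fx {j} x = fx {i, j} x := by
  simp only [fx, Finset.mem_singleton, forall_eq, Finset.mem_insert, forall_eq_or_imp]
  split_ifs <;> simp_all

lemma TT_fx {α : Type*} [Fintype α] [DecidableEq α] {c d : α} (hcd : d ≠ c) (S : Finset α)
    (hS : S ⊆ (Finset.univ.erase c).erase d) :
    ∑ g ∈ TT c d, fx S g = 2 * (Fintype.card α : ℝ) - 3 - 2 * S.card := by
  have hj : ∀ j ∈ S, j ≠ d ∧ j ≠ c := by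
    intro j hj
    have := hS hj
    simpa using this
  have key : ∀ a, (a = c ∨ a = d) → ∀ i, fx S (swap i a * swap d c) = if i ∉ S then 1 else 0 := by
    intro a ha i
    suffices hiff : (∀ j ∈ S, (swap i a * swap d c) j = j) ↔ i ∉ S by
      rw [fx]
      by_cases h : i ∈ S
      · rw [if_neg (fun h' => hiff.1 h' h), if_neg (not_not.2 h)]
      · rw [if_pos (hiff.2 h), if_pos h]
    constructor
    · intro h hi
      have h1 := h i hi
      rw [Perm.mul_apply, swap_apply_of_ne_of_ne (hj i hi).1 (hj i hi).2, swap_apply_left] at h1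
      rcases ha with rfl | rfl
      · exact (hj i hi).2 h1.symm
      · exact (hj i hi).1 h1.symm
    · intro hi j hjS
      rw [Perm.mul_apply, swap_apply_of_ne_of_ne (hj j hjS).1 (hj j hjS).2]
      apply swap_apply_of_ne_of_ne
      · rintro rfl; exact hi hjS
      · rcases ha with rfl | rfl
        · exact (hj j hjS).2
        · exact (hj j hjS).1
  have cnt : ∀ E : Finset α, S ⊆ E → ∑ i ∈ E, (if i ∉ S then (1 : ℝ) else 0) = E.card - S.card := by
    intro E hE
    rw [← Finset.sum_filter, Finset.filter_notMem_eq_sdiff, Finset.sum_const, nsmul_eq_mul, mul_one,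
      Finset.card_sdiff_of_subset hE, Nat.cast_sub (Finset.card_le_card hE)]
  have hc0 : ((TT c d).card : ℝ) = _ := card_TT hcd (by
    have : Nontrivial α := ⟨d, c, hcd⟩
    exact Fintype.one_lt_card)
  have hc1 := sum_TT hcd (fun _ => (1 : ℝ))
  simp only [Finset.sum_const, nsmul_eq_mul, mul_one] at hc1
  rw [sum_TT hcd, Finset.sum_congr rfl fun i _ => key c (Or.inl rfl) i,
    Finset.sum_congr rfl fun i _ => key d (Or.inr rfl) i, cnt _ hS,
    cnt _ (hS.trans (Finset.erase_subset _ _))]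
  linarith

lemma E_fx (n : ℕ) (hn : 3 ≤ n) (S : Finset (Fin n))
    (hS : S ⊆ (Finset.univ.erase (pc n hn)).erase (pd n hn)) (k : ℕ) :
    ∑ w : Fin k → alternatingGroup (Fin n), (∏ t, Pmeas n (w t)) * ∏ t, fx S (w t : Perm (Fin n)) =
      (1 - 2 * S.card / (2 * (n : ℝ) - 3)) ^ k := by
  simp only [← Finset.prod_mul_distrib]
  rw [← Fintype.sum_pow (fun x : alternatingGroup (Fin n) => Pmeas n x * fx S (x : Perm (Fin n))),
    sum_Pmeas n hn, TT_fx (pdc n hn) S hS, Fintype.card_fin]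
  have := Lpos n hn
  congr 1
  field_simp

/-- number of untouched points along a word -/
noncomputable def untouched (n : ℕ) (hn : 3 ≤ n) {k : ℕ} (w : Fin k → alternatingGroup (Fin n)) : ℝ :=
  ∑ j ∈ (Finset.univ.erase (pc n hn)).erase (pd n hn), ∏ t, fx {j} (w t : Perm (Fin n))

/-- expected number of untouched points -/
noncomputable def MM (n k : ℕ) : ℝ := ((n : ℝ) - 2) * (1 - 2 / (2 * (n : ℝ) - 3)) ^ k

lemma card_D (n : ℕ) (hn : 3 ≤ n) :
    (((Finset.univ.erase (pc n hn)).erase (pd n hn)).card : ℝ) = (n : ℝ) - 2 := by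
  rw [Finset.card_erase_of_mem (by simp [pdc]), Finset.card_erase_of_mem (by simp), Finset.card_univ,
    Fintype.card_fin, Nat.sub_sub, Nat.cast_sub (by omega)]
  norm_num

lemma E_untouched (n : ℕ) (hn : 3 ≤ n) (k : ℕ) :
    ∑ w : Fin k → alternatingGroup (Fin n), (∏ t, Pmeas n (w t)) * untouched n hn w = MM n k := by
  simp only [untouched, Finset.mul_sum]
  rw [Finset.sum_comm, Finset.sum_congr rfl fun j hj => E_fx n hn {j} (by simpa using hj) k]
  simp only [Finset.card_singleton]
  rw [Finset.sum_const, nsmul_eq_mul, card_D, MM]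
  simp

lemma E_untouched_sq (n : ℕ) (hn : 4 ≤ n) (k : ℕ) :
    ∑ w : Fin k → alternatingGroup (Fin n), (∏ t, Pmeas n (w t)) *
      untouched n (by omega : 3 ≤ n) w ^ 2 ≤ MM n k + MM n k ^ 2 := by
  have hn3 : 3 ≤ n := by omega
  have hL := Lpos n hn3
  have hn4 : (4 : ℝ) ≤ n := by exact_mod_cast hn
  set D := (Finset.univ.erase (pc n hn3)).erase (pd n hn3) with hD
  set L := 2 * (n : ℝ) - 3 with hLd
  have h1 : ∀ w : Fin k → alternatingGroup (Fin n), (∏ t, Pmeas n (w t)) * untouched n hn3 w ^ 2 =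
      ∑ i ∈ D, ∑ j ∈ D, (∏ t, Pmeas n (w t)) * ∏ t, fx {i, j} (w t : Perm (Fin n)) := by
    intro w
    rw [untouched, sq, Finset.sum_mul_sum, Finset.mul_sum]
    refine Finset.sum_congr rfl fun i _ => ?_
    rw [Finset.mul_sum]
    refine Finset.sum_congr rfl fun j _ => ?_
    rw [← Finset.prod_mul_distrib]
    simp only [fx_mul]
  have ha : 0 ≤ 1 - 2 / L := by
    rw [sub_nonneg, div_le_one hL]; linarith
  have hb : 0 ≤ 1 - 4 / L := by
    rw [sub_nonneg, div_le_one hL]; linarith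
  have hab : (1 - 4 / L) ^ k ≤ ((1 - 2 / L) ^ k) ^ 2 := by
    rw [← pow_mul, mul_comm k 2, pow_mul]
    refine pow_le_pow_left₀ hb ?_ k
    have : 0 ≤ (2 / L) ^ 2 := by positivity
    have h4 : 4 / L = 2 * (2 / L) := by ring
    rw [h4]; nlinarith
  have h2 : ∀ i ∈ D, ∀ j ∈ D, ∑ w : Fin k → alternatingGroup (Fin n),
      (∏ t, Pmeas n (w t)) * ∏ t, fx {i, j} (w t : Perm (Fin n)) ≤
      (if i = j then (1 - 2 / L) ^ k else 0) + ((1 - 2 / L) ^ k) ^ 2 := by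
    intro i hi j hj
    rw [E_fx n hn3 {i, j} (by intro z hz; simp at hz; rcases hz with rfl | rfl <;> assumption) k]
    by_cases hij : i = j
    · subst hij
      have : 0 ≤ ((1 - 2 / L) ^ k) ^ 2 := by positivity
      simp only [Finset.pair_eq_singleton, Finset.card_singleton, if_true, Nat.cast_one, mul_one]
      linarith
    · rw [if_neg hij, Finset.card_pair hij, zero_add]
      norm_num
      exact hab
  rw [Finset.sum_congr rfl fun w _ => h1 w, Finset.sum_comm]
  have h3 : ∀ i ∈ D, ∑ w : Fin k → alternatingGroup (Fin n), ∑ j ∈ D,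
      (∏ t, Pmeas n (w t)) * ∏ t, fx {i, j} (w t : Perm (Fin n)) ≤
      (1 - 2 / L) ^ k + ((n : ℝ) - 2) * ((1 - 2 / L) ^ k) ^ 2 := by
    intro i hi
    rw [Finset.sum_comm]
    refine (Finset.sum_le_sum (h2 i hi)).trans (le_of_eq ?_)
    rw [Finset.sum_add_distrib, Finset.sum_ite_eq, if_pos hi, Finset.sum_const, nsmul_eq_mul, hD, card_D]
  refine (Finset.sum_le_sum h3).trans (le_of_eq ?_)
  rw [Finset.sum_const, nsmul_eq_mul, hD, card_D, MM]
  ring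

/-- number of fixed points -/
noncomputable def fixn {n : ℕ} (x : Perm (Fin n)) : ℝ := ∑ j, fx {j} x

lemma untouched_le (n : ℕ) (hn : 3 ≤ n) {k : ℕ} (w : Fin k → alternatingGroup (Fin n)) :
    untouched n hn w ≤ fixn ((List.ofFn w).prod : Perm (Fin n)) := by
  rw [untouched, fixn]
  have hstep : ∀ j, ∏ t, fx {j} (w t : Perm (Fin n)) ≤ fx {j} ((List.ofFn w).prod : Perm (Fin n)) := by
    intro j
    by_cases h : ∀ t, (w t : Perm (Fin n)) j = j
    · have h2 : (((List.ofFn w).prod : alternatingGroup (Fin n)) : Perm (Fin n)) j = j := by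
        have : ∀ l : List (alternatingGroup (Fin n)), (∀ x ∈ l, (x : Perm (Fin n)) j = j) →
            ((l.prod : alternatingGroup (Fin n)) : Perm (Fin n)) j = j := by
          intro l
          induction l with
          | nil => intro _; simp
          | cons a l ih =>
            intro hl
            rw [List.prod_cons, Subgroup.coe_mul, Perm.mul_apply,
              ih fun x hx => hl x (List.mem_cons_of_mem _ hx)]
            exact hl a List.mem_cons_self
        apply this
        intro x hx
        obtain ⟨t, rfl⟩ := (List.mem_ofFn' _ _).1 hx
        exact h t
      have h3 : fx {j} ((List.ofFn w).prod : Perm (Fin n)) = 1 := by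
        rw [fx, if_pos]; simpa using h2
      rw [h3]
      exact Finset.prod_le_one (fun t _ => fx_nonneg _ _) (fun t _ => fx_le _ _)
    · push Not at h
      obtain ⟨t, ht⟩ := h
      rw [Finset.prod_eq_zero (Finset.mem_univ t)]
      · exact fx_nonneg _ _
      · rw [fx, if_neg]; simpa using ht
  refine (Finset.sum_le_sum fun j _ => hstep j).trans ?_
  exact Finset.sum_le_sum_of_subset_of_nonneg (Finset.subset_univ _) fun _ _ _ => fx_nonneg _ _

lemma sum_fixn (n : ℕ) (hn : 3 ≤ n) :
    ∑ x : alternatingGroup (Fin n), fixn (x : Perm (Fin n)) = Fintype.card (alternatingGroup (Fin n)) := by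
  have htr : MulAction.IsPretransitive (alternatingGroup (Fin n)) (Fin n) :=
    alternatingGroup.isPretransitive_of_three_le_card (Fin n) (by simpa using hn)
  have hss := (MulAction.pretransitive_iff_subsingleton_quotient (alternatingGroup (Fin n)) (Fin n)).1 htr
  have hB := MulAction.sum_card_fixedBy_eq_card_orbits_mul_card_group (alternatingGroup (Fin n)) (Fin n)
  have h1 : Fintype.card (MulAction.orbitRel.Quotient (alternatingGroup (Fin n)) (Fin n)) = 1 := by
    have : Nonempty (MulAction.orbitRel.Quotient (alternatingGroup (Fin n)) (Fin n)) :=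
      ⟨Quotient.mk _ (pc n hn)⟩
    exact Fintype.card_eq_one_iff.2 ⟨this.some, fun y => Subsingleton.elim _ _⟩
  have h2 : ∀ x : alternatingGroup (Fin n), fixn (x : Perm (Fin n)) =
      (Fintype.card (MulAction.fixedBy (Fin n) x) : ℝ) := by
    intro x
    have h3 : ∀ j, fx {j} (x : Perm (Fin n)) = if (x : Perm (Fin n)) j = j then 1 else 0 := by
      intro j; simp only [fx, Finset.mem_singleton, forall_eq]
    simp only [fixn, h3]
    rw [← Finset.sum_filter, Finset.sum_const, nsmul_eq_mul, mul_one, Fintype.card_subtype]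
    congr 2
  rw [Finset.sum_congr rfl fun x _ => h2 x, ← Nat.cast_sum]
  rw [h1, one_mul] at hB
  rw [hB]
end lower

section final
open Equiv

lemma tv_nonneg {Ω : Type*} [Fintype Ω] (p q : Ω → ℝ) : 0 ≤ tvDist p q := by
  rw [tvDist]
  have : 0 ≤ ∑ ω, |p ω - q ω| := Finset.sum_nonneg fun _ _ => abs_nonneg _
  linarith

lemma unif_sum {Ω : Type*} [Fintype Ω] [Nonempty Ω] : ∑ x, unif Ω x = 1 := by
  have : (Fintype.card Ω : ℝ) ≠ 0 := by exact_mod_cast Fintype.card_ne_zero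
  simp only [unif, Finset.sum_const, nsmul_eq_mul, Finset.card_univ]
  field_simp

lemma tv_le_one (n : ℕ) (hn : 3 ≤ n) (k : ℕ) :
    tvDist (convPow (Pmeas n) k) (unif (alternatingGroup (Fin n))) ≤ 1 := by
  rw [tvDist]
  have h1 : ∑ x, convPow (Pmeas n) k x = 1 := sum_convPow _ (Pmeas_sum n hn) k
  have h2 : ∑ x, unif (alternatingGroup (Fin n)) x = 1 := unif_sum
  have h3 : ∑ x, |convPow (Pmeas n) k x - unif (alternatingGroup (Fin n)) x| ≤
      ∑ x, (convPow (Pmeas n) k x + unif (alternatingGroup (Fin n)) x) := by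
    refine Finset.sum_le_sum fun x _ => ?_
    have a := convPow_nonneg _ (Pmeas_nonneg n hn) k x
    have b : 0 ≤ unif (alternatingGroup (Fin n)) x := by rw [unif]; positivity
    rw [abs_le]; constructor <;> linarith
  rw [Finset.sum_add_distrib, h1, h2] at h3
  linarith

lemma tv_lower (n : ℕ) (hn : 4 ≤ n) (k : ℕ) (hM : 0 < MM n k) :
    1 - 6 / MM n k ≤ tvDist (convPow (Pmeas n) k) (unif (alternatingGroup (Fin n))) := by
  have hn3 : 3 ≤ n := by omega
  set M := MM n k with hMd
  set p := convPow (Pmeas n) k with hp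
  set u := unif (alternatingGroup (Fin n)) with hu
  have hsp : ∑ x, p x = 1 := sum_convPow _ (Pmeas_sum n hn3) k
  have hsu : ∑ x, u x = 1 := unif_sum
  have hu0 : ∀ x, 0 ≤ u x := fun x => by rw [hu, unif]; positivity
  set f : alternatingGroup (Fin n) → ℝ := fun x => if fixn (x : Perm (Fin n)) < M / 2 then 1 else 0 with hf
  -- word side
  have hq0 : ∀ w : Fin k → alternatingGroup (Fin n), 0 ≤ ∏ t, Pmeas n (w t) := fun w =>
    Finset.prod_nonneg fun t _ => Pmeas_nonneg n hn3 _
  have hq1 : ∑ w : Fin k → alternatingGroup (Fin n), ∏ t, Pmeas n (w t) = 1 := by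
    rw [← Fintype.sum_pow (Pmeas n), Pmeas_sum n hn3, one_pow]
  have hvar : ∑ w : Fin k → alternatingGroup (Fin n), (∏ t, Pmeas n (w t)) *
      (untouched n hn3 w - M) ^ 2 ≤ M := by
    have e : ∀ w : Fin k → alternatingGroup (Fin n), (∏ t, Pmeas n (w t)) * (untouched n hn3 w - M) ^ 2 =
        (∏ t, Pmeas n (w t)) * untouched n hn3 w ^ 2 -
          2 * M * ((∏ t, Pmeas n (w t)) * untouched n hn3 w) + M ^ 2 * ∏ t, Pmeas n (w t) := by
      intro w; ring
    rw [Finset.sum_congr rfl fun w _ => e w, Finset.sum_add_distrib, Finset.sum_sub_distrib,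
      ← Finset.mul_sum, ← Finset.mul_sum, hq1, E_untouched n hn3 k]
    have := E_untouched_sq n hn k
    nlinarith
  have hfp : ∑ x, p x * f x ≤ 4 / M := by
    rw [hp, sum_words]
    have h1 : ∀ w : Fin k → alternatingGroup (Fin n), (∏ t, Pmeas n (w t)) * f (List.ofFn w).prod ≤
        (4 / M ^ 2) * ((∏ t, Pmeas n (w t)) * (untouched n hn3 w - M) ^ 2) := by
      intro w
      have hle := untouched_le n hn3 w
      have : f (List.ofFn w).prod ≤ (4 / M ^ 2) * (untouched n hn3 w - M) ^ 2 := by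
        simp only [hf]
        split_ifs with h
        · rw [div_mul_eq_mul_div, le_div_iff₀ (by positivity)]
          nlinarith
        · positivity
      have := mul_le_mul_of_nonneg_left this (hq0 w)
      linarith
    refine (Finset.sum_le_sum fun w _ => h1 w).trans ?_
    rw [← Finset.mul_sum]
    refine (mul_le_mul_of_nonneg_left hvar (by positivity)).trans (le_of_eq ?_)
    field_simp
  -- uniform side
  have hfu : ∑ x, u x * (1 - f x) ≤ 2 / M := by
    have h1 : ∀ x, u x * (1 - f x) ≤ (2 / M) * (u x * fixn (x : Perm (Fin n))) := by
      intro x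
      have h0 : 0 ≤ fixn (x : Perm (Fin n)) := Finset.sum_nonneg fun _ _ => fx_nonneg _ _
      have : 1 - f x ≤ (2 / M) * fixn (x : Perm (Fin n)) := by
        simp only [hf]
        split_ifs with h
        · rw [sub_self]; positivity
        · rw [div_mul_eq_mul_div, le_div_iff₀ hM]
          linarith
      have := mul_le_mul_of_nonneg_left this (hu0 x)
      linarith
    refine (Finset.sum_le_sum fun w _ => h1 w).trans (le_of_eq ?_)
    rw [← Finset.mul_sum]
    have h2 : ∑ x, u x * fixn (x : Perm (Fin n)) = 1 := by
      simp only [hu, unif]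
      rw [← Finset.mul_sum, sum_fixn n hn3]
      have : (Fintype.card (alternatingGroup (Fin n)) : ℝ) ≠ 0 := by exact_mod_cast Fintype.card_ne_zero
      field_simp
    rw [h2, mul_one]
  have hfu' : ∑ x, u x * f x = 1 - ∑ x, u x * (1 - f x) := by
    have : ∑ x, u x * (1 - f x) = ∑ x, u x - ∑ x, u x * f x := by
      rw [← Finset.sum_sub_distrib]
      exact Finset.sum_congr rfl fun x _ => by ring
    rw [this, hsu]; ring
  have habs : ∑ x, (p x - u x) * (1 - 2 * f x) ≤ ∑ x, |p x - u x| := by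
    refine Finset.sum_le_sum fun x _ => ?_
    have h1 := le_abs_self (p x - u x)
    have h2 := neg_abs_le (p x - u x)
    simp only [hf]
    split_ifs <;> linarith
  have hexp : ∑ x, (p x - u x) * (1 - 2 * f x) =
      ∑ x, p x - ∑ x, u x - 2 * ∑ x, p x * f x + 2 * ∑ x, u x * f x := by
    rw [Finset.mul_sum, Finset.mul_sum, ← Finset.sum_sub_distrib, ← Finset.sum_sub_distrib,
      ← Finset.sum_add_distrib]
    refine Finset.sum_congr rfl fun x _ => by ring
  rw [hexp, hsp, hsu, hfu'] at habs
  rw [tvDist]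
  have : 6 / M = 4 / M + 2 / M := by ring
  linarith

lemma MM_lower (n : ℕ) (hn : 8 ≤ n) (c : ℝ) (hc : c ≤ 0) (hnc : Real.exp (-c - 1) / 2 ≤ (n : ℝ) - 2) :
    Real.exp (-c - 1) / 2 ≤ MM n ⌈((n : ℝ) - 3 / 2) * Real.log n + c * n⌉₊ := by
  have hn8 : (8 : ℝ) ≤ n := by exact_mod_cast hn
  set y := ((n : ℝ) - 3 / 2) * Real.log n + c * n with hy
  rw [MM]
  rcases le_or_gt y 0 with h0 | h0
  · rw [Nat.ceil_eq_zero.2 h0, pow_zero, mul_one]; exact hnc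
  have hk : (⌈y⌉₊ : ℝ) < y + 1 := Nat.ceil_lt_add_one h0.le
  set k := ⌈y⌉₊
  have hL : 0 < 2 * (n : ℝ) - 3 := by linarith
  have hL5 : 0 < (n : ℝ) - 5 / 2 := by linarith
  have ha : 1 - 2 / (2 * (n : ℝ) - 3) = (2 * (n : ℝ) - 5) / (2 * (n : ℝ) - 3) := by
    field_simp; ring
  have ha0 : 0 < 1 - 2 / (2 * (n : ℝ) - 3) := by
    rw [ha]; apply div_pos <;> linarith
  have hlog : -(1 / ((n : ℝ) - 5 / 2)) ≤ Real.log (1 - 2 / (2 * (n : ℝ) - 3)) := by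
    refine le_trans (le_of_eq ?_) (Real.one_sub_inv_le_log_of_pos ha0)
    have : 2 * (n : ℝ) - 5 ≠ 0 := by linarith
    rw [ha, inv_div, show (n : ℝ) - 5 / 2 = (2 * n - 5) / 2 by ring, one_div_div, eq_sub_iff_add_eq,
      ← neg_div, ← add_div, div_eq_one_iff_eq this]
    ring
  have hlogn : Real.log n ≤ n / 4 + 2 := by
    have h1 := Real.log_le_sub_one_of_pos (show (0 : ℝ) < n / 4 by linarith)
    rw [Real.log_div (by linarith) (by norm_num)] at h1
    have h2 := Real.log_le_sub_one_of_pos (show (0 : ℝ) < 4 by norm_num)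
    linarith
  have hkk : (k : ℝ) * (1 / ((n : ℝ) - 5 / 2)) ≤ Real.log n + c + 1 := by
    rw [mul_one_div, div_le_iff₀ hL5]
    nlinarith
  have hpow : Real.exp (-(Real.log n + c + 1)) ≤ (1 - 2 / (2 * (n : ℝ) - 3)) ^ k := by
    rw [← Real.exp_log ha0, ← Real.exp_nat_mul]
    apply Real.exp_le_exp.2
    have := mul_le_mul_of_nonneg_left hlog (Nat.cast_nonneg (α := ℝ) k)
    linarith
  have he : Real.exp (-(Real.log n + c + 1)) = Real.exp (-c - 1) / n := by
    rw [show -(Real.log n + c + 1) = (-c - 1) - Real.log n by ring, Real.exp_sub,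
      Real.exp_log (by linarith)]
  rw [he] at hpow
  have hE := Real.exp_pos (-c - 1)
  calc Real.exp (-c - 1) / 2 ≤ ((n : ℝ) - 2) * (Real.exp (-c - 1) / n) := by
        rw [← mul_div_assoc, div_le_div_iff₀ (by norm_num) (by linarith)]
        nlinarith
    _ ≤ _ := mul_le_mul_of_nonneg_left hpow (by linarith)

lemma tv_lower' (n : ℕ) (hn : 8 ≤ n) (c : ℝ) (hc : c ≤ 0) (hnc : Real.exp (-c - 1) / 2 ≤ (n : ℝ) - 2) :
    1 - 12 * Real.exp (c + 1) ≤
      tvDist (convPow (Pmeas n) ⌈((n : ℝ) - 3 / 2) * Real.log n + c * n⌉₊) (unif (alternatingGroup (Fin n))) := by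
  have h := MM_lower n hn c hc hnc
  have hE := Real.exp_pos (-c - 1)
  refine le_trans ?_ (tv_lower n (by omega) _ (lt_of_lt_of_le (by positivity) h))
  have : 6 / MM n ⌈((n : ℝ) - 3 / 2) * Real.log n + c * n⌉₊ ≤ 6 / (Real.exp (-c - 1) / 2) := by
    gcongr
  have h2 : 6 / (Real.exp (-c - 1) / 2) = 12 * Real.exp (c + 1) := by
    rw [show c + 1 = -(-c - 1) by ring, Real.exp_neg]
    field_simp
    norm_num
  linarith
end final

theorem cutoff_P :
    Filter.Tendsto (fun c : ℝ =>
        Filter.limsup (fun n : ℕ =>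
          tvDist (convPow (Pmeas n) ⌈((n : ℝ) - 3 / 2) * Real.log n + c * n⌉₊)
            (unif (alternatingGroup (Fin n)))) Filter.atTop)
      Filter.atTop (nhds 0) ∧
    Filter.Tendsto (fun c : ℝ =>
        Filter.liminf (fun n : ℕ =>
          tvDist (convPow (Pmeas n) ⌈((n : ℝ) - 3 / 2) * Real.log n + c * n⌉₊)
            (unif (alternatingGroup (Fin n)))) Filter.atTop)
      Filter.atBot (nhds 1) := by
  have hle : ∀ c : ℝ, ∀ᶠ n : ℕ in atTop,
      tvDist (convPow (Pmeas n) ⌈((n : ℝ) - 3 / 2) * Real.log n + c * n⌉₊)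
            (unif (alternatingGroup (Fin n))) ≤ 1 := fun c => by
    filter_upwards [eventually_ge_atTop 3] with n hn using tv_le_one n hn _
  have hge : ∀ c : ℝ, ∀ᶠ n : ℕ in atTop,
      0 ≤ tvDist (convPow (Pmeas n) ⌈((n : ℝ) - 3 / 2) * Real.log n + c * n⌉₊)
            (unif (alternatingGroup (Fin n))) := fun c => Eventually.of_forall fun n => tv_nonneg _ _
  have hbl : ∀ c : ℝ, IsBoundedUnder (· ≤ ·) atTop (fun n : ℕ =>
      tvDist (convPow (Pmeas n) ⌈((n : ℝ) - 3 / 2) * Real.log n + c * n⌉₊)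
            (unif (alternatingGroup (Fin n)))) := fun c => ⟨1, by simpa using hle c⟩
  have hbg : ∀ c : ℝ, IsBoundedUnder (· ≥ ·) atTop (fun n : ℕ =>
      tvDist (convPow (Pmeas n) ⌈((n : ℝ) - 3 / 2) * Real.log n + c * n⌉₊)
            (unif (alternatingGroup (Fin n)))) := fun c => ⟨0, by simpa using hge c⟩
  constructor
  · have hlim : Tendsto (fun c : ℝ => Real.sqrt (Real.exp (Real.exp (-(2 * c))) - 1)) atTop (nhds 0) := by
      have h1 : Tendsto (fun c : ℝ => Real.exp (-(2 * c))) atTop (nhds 0) :=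
        Real.tendsto_exp_neg_atTop_nhds_zero.comp (tendsto_id.const_mul_atTop (by norm_num))
      have h2 : Continuous (fun t : ℝ => Real.sqrt (Real.exp t - 1)) := by fun_prop
      have h3 := (h2.tendsto 0).comp h1
      simpa [Function.comp_def] using h3
    refine squeeze_zero' (Eventually.of_forall fun c => ?_) ?_ hlim
    · exact le_limsup_of_frequently_le (hge c).frequently (hbl c)
    · filter_upwards [eventually_ge_atTop 0] with c hc
      refine limsup_le_of_le (hbg c).isCoboundedUnder_le ?_
      filter_upwards [eventually_ge_atTop 3] with n hn using tv_upper' n hn c hc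
  · have hlim : Tendsto (fun c : ℝ => 1 - 12 * Real.exp (c + 1)) atBot (nhds 1) := by
      have h1 : Tendsto (fun c : ℝ => Real.exp (c + 1)) atBot (nhds 0) :=
        Real.tendsto_exp_atBot.comp (tendsto_atBot_add_const_right _ 1 tendsto_id)
      simpa using (h1.const_mul 12).const_sub 1
    refine tendsto_of_tendsto_of_tendsto_of_le_of_le' hlim tendsto_const_nhds ?_
      (Eventually.of_forall fun c => ?_)
    · filter_upwards [eventually_le_atBot 0] with c hc
      refine le_liminf_of_le (hbl c).isCoboundedUnder_ge ?_
      filter_upwards [eventually_ge_atTop 8,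
        (tendsto_natCast_atTop_atTop (R := ℝ)).eventually_ge_atTop (Real.exp (-c - 1) / 2 + 2)] with n hn hn2
      exact tv_lower' n hn c hc (by linarith)
    · exact liminf_le_of_frequently_le (hle c).frequently (hbg c)
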